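/- arXiv:2508.08658 — 3 statements merged into one kernel-verified Lean document; each statement's English description precedes it below -/
import Mathlib

section
/- Under the above setup, for every comparator sequence (P̃_i^{t*}) with P̃_i^{t*} ∈ Ω_i for all i ∈ {1,…,M} and all t ∈ {0,…,T}, and with Σ_{i=1}^M G̃_i^t(P̃_i^{t*}) = 0 for every t ∈ {1,…,T}, the iterates of Algorithm 1 satisfy the accumulative constraint-violation bound: ‖Σ_{t=1}^T Σ_{i=1}^M G̃_i^t(P_i^t)‖² ≤ (2MθT + 2M/β)·[ (R/α)·Σ_{t=1}^T Σ_{i=1}^M ‖P̃_i^{t*} − P̃_i^{(t−1)*}‖ + (1/(2α))·Σ_{i=1}^M ‖P_i^1 − P̃_i^{0*}‖² + φ²·M·α·T + (ψ̃²/M)·α·T/θ² + (4ψ̃²M/ε̃^{3/2} + 2ψ̃²M)·β·T + 2MF·T ]. -/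
open scoped RealInnerProductSpace
open Finset

lemma aux_small {a b : ℝ} (h : ∀ s : ℝ, 0 < s → s ≤ 1 → 0 ≤ s * a + s ^ 2 * b) : 0 ≤ a := by
  by_contra hc
  push Not at hc
  have hb : 0 < |b| + 1 := by positivity
  have hab := le_abs_self b
  set s := min 1 (-a / (2 * (|b| + 1))) with hs
  have hs0 : 0 < s := lt_min one_pos (div_pos (by linarith) (by linarith))
  have hs1 : s ≤ 1 := min_le_left _ _
  have hs2 : s * (2 * (|b| + 1)) ≤ -a := by
    rw [← le_div_iff₀ (by linarith)]; exact min_le_right _ _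
  have h1 := h s hs0 hs1
  have h2 : 0 ≤ a + s * b := by
    have : 0 ≤ s * (a + s * b) := by nlinarith
    exact nonneg_of_mul_nonneg_right this hs0
  nlinarith

section
variable {E : Type*} [NormedAddCommGroup E] [InnerProductSpace ℝ E]

lemma aux_prox {S : Set E} (hS : Convex ℝ S) {α : ℝ} (hα : 0 < α) {p q u : E} (hq : q ∈ S)
    (hmin : ∀ x ∈ S, ⟪q - p, u⟫ + (1 / (2 * α)) * ‖q - p‖ ^ 2
      ≤ ⟪x - p, u⟫ + (1 / (2 * α)) * ‖x - p‖ ^ 2) {x : E} (hx : x ∈ S) :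
    ⟪p - x, u⟫ ≤ (1 / (2 * α)) * (‖p - x‖ ^ 2 - ‖q - x‖ ^ 2) + α / 2 * ‖u‖ ^ 2 := by
  have key : 0 ≤ ⟪x - q, u⟫ + (1 / α) * ⟪q - p, x - q⟫ := by
    apply aux_small (b := (1 / (2 * α)) * ‖x - q‖ ^ 2)
    intro s hs0 hs1
    have hm : q + s • (x - q) ∈ S := hS.add_smul_sub_mem hq hx ⟨hs0.le, hs1⟩
    have h := hmin _ hm
    have e : q + s • (x - q) - p = (q - p) + s • (x - q) := by abel
    rw [e, norm_add_sq_real, inner_add_left, inner_smul_left, inner_smul_right, norm_smul,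
      mul_pow, Real.norm_eq_abs, sq_abs] at h
    simp only [conj_trivial] at h
    have e2 : 1 / (2 * α) * 2 = 1 / α := by field_simp
    have : s * (1 / α * ⟪q - p, x - q⟫) = 1 / (2 * α) * (2 * (s * ⟪q - p, x - q⟫)) := by
      rw [← e2]; ring
    nlinarith
  have h1 : ‖p - x‖ ^ 2 = ‖q - p‖ ^ 2 + 2 * ⟪q - p, x - q⟫ + ‖q - x‖ ^ 2 := by
    have : p - x = -((q - p) + (x - q)) := by abel
    rw [this, norm_neg, norm_add_sq_real, norm_sub_rev x q]
  have h2 : ⟪p - x, u⟫ = ⟪p - q, u⟫ - ⟪x - q, u⟫ := by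
    rw [← inner_sub_left]; congr 1; abel
  have h3 : ⟪p - q, u⟫ ≤ (1 / (2 * α)) * ‖q - p‖ ^ 2 + α / 2 * ‖u‖ ^ 2 := by
    have h4 := real_inner_le_norm (p - q) u
    rw [norm_sub_rev] at h4
    have h5 : (1 / (2 * α)) * ‖q - p‖ ^ 2 + α / 2 * ‖u‖ ^ 2 - ‖q - p‖ * ‖u‖
        = (1 / (2 * α)) * (‖q - p‖ - α * ‖u‖) ^ 2 := by field_simp; ring
    have h6 : 0 ≤ (1 / (2 * α)) * (‖q - p‖ - α * ‖u‖) ^ 2 := by positivity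
    linarith
  rw [h1, h2]
  have e3 : 1 / (2 * α) * (‖q - p‖ ^ 2 + 2 * ⟪q - p, x - q⟫ + ‖q - x‖ ^ 2 - ‖q - x‖ ^ 2)
    = 1 / (2 * α) * ‖q - p‖ ^ 2 + 1 / α * ⟪q - p, x - q⟫ := by field_simp; ring
  rw [e3]
  linarith

lemma aux_convex_grad [CompleteSpace E] {f : E → ℝ} (hf : ConvexOn ℝ Set.univ f) {x g : E}
    (hg : HasGradientAt f g x) (y : E) : f x + ⟪y - x, g⟫ ≤ f y := by
  have hd : HasDerivAt (fun s : ℝ => f (x + s • (y - x))) ⟪y - x, g⟫ 0 := by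
    have h1 : HasDerivAt (fun s : ℝ => x + s • (y - x)) (y - x) 0 := by
      simpa using ((hasDerivAt_id (0 : ℝ)).smul_const (y - x)).const_add x
    have h2 : HasFDerivAt f (InnerProductSpace.toDual ℝ E g) (x + (0 : ℝ) • (y - x)) := by
      simpa using hg.hasFDerivAt
    have := h2.comp_hasDerivAt (0 : ℝ) h1
    rw [real_inner_comm]
    simp only [InnerProductSpace.toDual_apply_apply] at this
    exact this
  have hc : ConvexOn ℝ Set.univ (fun s : ℝ => f (x + s • (y - x))) := by
    refine ⟨convex_univ, ?_⟩
    intro s _ t _ a b ha hb hab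
    have := hf.2 (Set.mem_univ (x + s • (y - x))) (Set.mem_univ (x + t • (y - x))) ha hb hab
    convert this using 2
    obtain rfl : b = 1 - a := by linarith
    simp only [smul_eq_mul]
    module
  have := hc.le_slope_of_hasDerivAt (Set.mem_univ 0) (Set.mem_univ 1) one_pos hd
  simp [slope_def_field] at this
  linarith

/-- Jensen for squared norm. -/
lemma aux_jensen {M : ℕ} (w : Fin M → ℝ) (hw : ∀ j, 0 ≤ w j) (hw1 : ∑ j, w j = 1)
    (v : Fin M → E) : ‖∑ j, w j • v j‖ ^ 2 ≤ ∑ j, w j * ‖v j‖ ^ 2 := by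
  have hc : ConvexOn ℝ Set.univ (fun x : E => ‖x‖ ^ 2) :=
    (convexOn_norm convex_univ).pow (fun _ _ => norm_nonneg _) 2
  simpa using hc.map_sum_le (t := Finset.univ) (w := w) (p := v) (fun j _ => hw j) hw1
    (fun _ _ => Set.mem_univ _)

lemma aux_stoch {M : ℕ} (A : Matrix (Fin M) (Fin M) ℝ) (hA : ∀ i j, 0 ≤ A i j)
    (hr : ∀ i, ∑ j, A i j = 1) (hc : ∀ j, ∑ i, A i j = 1) (v : Fin M → E) (c : E) :
    ∑ i, ‖∑ j, A i j • v j - c‖ ^ 2 ≤ ∑ j, ‖v j - c‖ ^ 2 := by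
  calc ∑ i, ‖∑ j, A i j • v j - c‖ ^ 2 = ∑ i, ‖∑ j, A i j • (v j - c)‖ ^ 2 := by
        refine Finset.sum_congr rfl fun i _ => ?_
        simp only [smul_sub, Finset.sum_sub_distrib, ← Finset.sum_smul, hr, one_smul]
    _ ≤ ∑ i, ∑ j, A i j * ‖v j - c‖ ^ 2 :=
        Finset.sum_le_sum fun i _ => aux_jensen _ (hA i) (hr i) _
    _ = ∑ j, ‖v j - c‖ ^ 2 := by
        rw [Finset.sum_comm]
        simp only [← Finset.sum_mul, hc, one_mul]

/-- One step of the dual recursion. -/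
lemma aux_dual {β θ ψ : ℝ} (hβ : 0 < β) (hθ : 0 < θ) (l g c : E) (hg : ‖g‖ ≤ ψ)
    (hl : ‖l‖ ≤ ψ / θ) :
    ‖l + β • (g - θ • l) - c‖ ^ 2 ≤ ‖l - c‖ ^ 2 + 2 * β * ⟪l - c, g⟫ + β * θ * ‖c‖ ^ 2
      + 4 * β ^ 2 * ψ ^ 2 := by
  have e : l + β • (g - θ • l) - c = (l - c) + β • (g - θ • l) := by abel
  rw [e, norm_add_sq_real, inner_smul_right, norm_smul, mul_pow, Real.norm_eq_abs, sq_abs,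
    inner_sub_right, inner_smul_right]
  have h1 : ‖g - θ • l‖ ≤ 2 * ψ := by
    have := norm_sub_le g (θ • l)
    rw [norm_smul, Real.norm_eq_abs, abs_of_pos hθ] at this
    have : θ * ‖l‖ ≤ ψ := by rw [le_div_iff₀ hθ] at hl; linarith
    linarith
  have h2 : ‖g - θ • l‖ ^ 2 ≤ (2 * ψ) ^ 2 := by gcongr
  have h3 : ‖l - c‖ ^ 2 = ‖l‖ ^ 2 - 2 * ⟪l, c⟫ + ‖c‖ ^ 2 := norm_sub_sq_real l c
  have h4 : ⟪l - c, l⟫ = ‖l‖ ^ 2 - ⟪l, c⟫ := by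
    rw [inner_sub_left, real_inner_self_eq_norm_sq, real_inner_comm]
  have h5 : 0 ≤ ‖l‖ ^ 2 := by positivity
  have h6 : - 2 * ⟪l - c, l⟫ ≤ ‖c‖ ^ 2 := by nlinarith [sq_nonneg ‖l - c‖]
  have h7 : β * θ * (- 2 * ⟪l - c, l⟫) ≤ β * θ * ‖c‖ ^ 2 := by gcongr
  have h8 : β ^ 2 * ‖g - θ • l‖ ^ 2 ≤ β ^ 2 * (2 * ψ) ^ 2 := by gcongr
  nlinarith
end

/-- Operator norm acting on stacked vectors. -/
lemma aux_op {M d : ℕ} (A : Matrix (Fin M) (Fin M) ℝ)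
    (v : Fin M → EuclideanSpace ℝ (Fin d)) :
    ∑ i, ‖∑ j, A i j • v j‖ ^ 2 ≤
      ‖LinearMap.toContinuousLinearMap (Matrix.toEuclideanLin A)‖ ^ 2 * ∑ j, ‖v j‖ ^ 2 := by
  have h : ∀ k, ∑ i, (∑ j, A i j * v j k) ^ 2 ≤
      ‖LinearMap.toContinuousLinearMap (Matrix.toEuclideanLin A)‖ ^ 2 * ∑ j, (v j k) ^ 2 := by
    intro k
    have := (LinearMap.toContinuousLinearMap (Matrix.toEuclideanLin A)).le_opNorm
      (WithLp.toLp 2 fun j => v j k)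
    have h2 := pow_le_pow_left₀ (norm_nonneg _) this 2
    rw [mul_pow, EuclideanSpace.norm_sq_eq, EuclideanSpace.norm_sq_eq] at h2
    simpa [Matrix.mulVec, dotProduct] using h2
  have h3 := Finset.sum_le_sum fun k (_ : k ∈ Finset.univ) => h k
  rw [← Finset.mul_sum, Finset.sum_comm, Finset.sum_comm (s := Finset.univ (α := Fin d))] at h3
  simpa [EuclideanSpace.norm_sq_eq] using h3

lemma aux_tel (f : ℕ → ℝ) (T : ℕ) :
    ∑ t ∈ Finset.Icc 1 T, (f t - f (t + 1)) = f 1 - f (T + 1) := by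
  induction T with
  | zero => simp
  | succ n ih => rw [Finset.sum_Icc_succ_top (by omega), ih]; ring

/-- Consensus error bound. -/
lemma aux_cons {M d T : ℕ} (hM : 1 ≤ M) (Et : Matrix (Fin M) (Fin M) ℝ)
    (hErow : ∀ i, ∑ j, Et i j = 1) (hEcol : ∀ j, ∑ i, Et i j = 1)
    (k : ℝ) (hk : k = ‖LinearMap.toContinuousLinearMap
        (Matrix.toEuclideanLin (Et - Matrix.of fun _ _ => (M : ℝ)⁻¹))‖)
    (hk1 : k < 1) {β θ ψ : ℝ} (hβ : 0 < β) (hθ : 0 < θ) (hβθ : β * θ ≤ 1) (hψ : 0 ≤ ψ)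
    (lam g : Fin M → ℕ → EuclideanSpace ℝ (Fin d))
    (hlam0 : ∀ i, lam i 0 = 0)
    (hg : ∀ i, ∀ t ≤ T, ‖g i t‖ ≤ ψ)
    (hstep : ∀ i, ∀ t ≤ T, lam i (t + 1) =
      ∑ j, Et i j • (lam j t + β • (g j t - θ • lam j t))) :
    ∀ t ≤ T, ∑ i, ‖lam i t - (M : ℝ)⁻¹ • ∑ j, lam j t‖ ≤ β * ψ * M * (k / (1 - k)) := by
  have hM0 : (0 : ℝ) < M := by exact_mod_cast hM
  have hk0 : 0 ≤ k := hk ▸ norm_nonneg _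
  set dev : ℕ → Fin M → EuclideanSpace ℝ (Fin d) :=
    fun t i => lam i t - (M : ℝ)⁻¹ • ∑ j, lam j t with hdev
  obtain ⟨A, hAdef⟩ : ∃ A : Matrix (Fin M) (Fin M) ℝ,
    A = Et - Matrix.of fun _ _ => (M : ℝ)⁻¹ := ⟨_, rfl⟩
  rw [← hAdef] at hk
  have hAij : ∀ i j, A i j = Et i j - (M : ℝ)⁻¹ := by intro i j; rw [hAdef]; rfl
  have hrec : ∀ t ≤ T, ∀ i, dev (t + 1) i =
      ∑ j, A i j • ((1 - β * θ) • dev t j + β • g j t) := by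
    intro t ht i
    have hA : ∑ j, A i j = 0 := by
      simp [hAij, hErow, Finset.sum_sub_distrib, hM0.ne']
    have h1 : ∀ j, (1 - β * θ) • dev t j + β • g j t =
        (lam j t + β • (g j t - θ • lam j t)) - (1 - β * θ) • ((M : ℝ)⁻¹ • ∑ j, lam j t) := by
      intro j; simp only [hdev]; module
    simp only [h1, smul_sub (_ : ℝ) (lam _ t + β • (g _ t - θ • lam _ t))]
    rw [Finset.sum_sub_distrib, ← Finset.sum_smul, hA, zero_smul, sub_zero]
    simp only [hdev]
    have h2 : ∑ j, lam j (t + 1) = ∑ j, (lam j t + β • (g j t - θ • lam j t)) := by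
      rw [Finset.sum_congr rfl fun j _ => hstep j t ht, Finset.sum_comm]
      simp only [← Finset.sum_smul, hEcol, one_smul]
    rw [h2, hstep i t ht, Finset.smul_sum, ← Finset.sum_sub_distrib]
    simp only [hAij, sub_smul]
  set n : ℕ → ℝ := fun t => ‖(WithLp.toLp 2 (dev t) :
    PiLp 2 (fun _ : Fin M => EuclideanSpace ℝ (Fin d)))‖ with hn
  have hn2 : ∀ t, n t ^ 2 = ∑ i, ‖dev t i‖ ^ 2 := by
    intro t; simp only [hn]; rw [PiLp.norm_sq_eq_of_L2]
  have hnrec : ∀ t ≤ T, n (t + 1) ≤ k * (n t + β * (ψ * √M)) := by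
    intro t ht
    set w : PiLp 2 (fun _ : Fin M => EuclideanSpace ℝ (Fin d)) :=
      (1 - β * θ) • WithLp.toLp 2 (dev t) + β • WithLp.toLp 2 (fun j => g j t) with hw
    have h1 : n (t + 1) ^ 2 ≤ (k * ‖w‖) ^ 2 := by
      rw [hn2, mul_pow, PiLp.norm_sq_eq_of_L2, hk, Finset.sum_congr rfl
        fun i _ => by rw [hrec t ht i]]
      exact aux_op _ _
    have h2 : n (t + 1) ≤ k * ‖w‖ := by
      exact le_of_sq_le_sq h1 (by positivity)
    have hgn : ‖(WithLp.toLp 2 (fun j => g j t) :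
        PiLp 2 (fun _ : Fin M => EuclideanSpace ℝ (Fin d)))‖ ≤ ψ * √M := by
      apply le_of_sq_le_sq _ (by positivity)
      rw [PiLp.norm_sq_eq_of_L2, mul_pow, Real.sq_sqrt hM0.le]
      calc ∑ i, ‖g i t‖ ^ 2 ≤ ∑ i : Fin M, ψ ^ 2 :=
            Finset.sum_le_sum fun i _ => pow_le_pow_left₀ (norm_nonneg _) (hg i t ht) 2
        _ = ψ ^ 2 * M := by simp; ring
    have h3 : ‖w‖ ≤ n t + β * (ψ * √M) := by
      refine (norm_add_le _ _).trans ?_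
      rw [norm_smul, norm_smul, Real.norm_eq_abs, Real.norm_eq_abs, abs_of_pos hβ,
        abs_of_nonneg (by linarith)]
      have hnt : 0 ≤ n t := norm_nonneg _
      have hbt : 0 < β * θ := by positivity
      have : (1 - β * θ) * n t ≤ n t := by nlinarith
      have h4 : β * ‖(WithLp.toLp 2 (fun j => g j t) :
        PiLp 2 (fun _ : Fin M => EuclideanSpace ℝ (Fin d)))‖ ≤ β * (ψ * √M) := by gcongr
      exact add_le_add this h4
    exact h2.trans (by gcongr)
  have hnb : ∀ t ≤ T, n t ≤ β * (ψ * √M) * (k / (1 - k)) := by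
    have h1k : 0 < 1 - k := by linarith
    intro t
    induction t with
    | zero =>
      intro _
      have : n 0 = 0 := by
        have h := hn2 0
        simp [hdev, hlam0] at h
        exact h
      rw [this]; positivity
    | succ t ih =>
      intro ht
      have h1 := ih (by omega)
      calc n (t + 1) ≤ k * (n t + β * (ψ * √M)) := hnrec t (by omega)
        _ ≤ k * (β * (ψ * √M) * (k / (1 - k)) + β * (ψ * √M)) := by gcongr
        _ = β * (ψ * √M) * (k / (1 - k)) := by field_simp; ring
  intro t ht
  have hcs : (∑ i, ‖dev t i‖) ^ 2 ≤ (√M * n t) ^ 2 := by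
    rw [mul_pow, Real.sq_sqrt hM0.le, hn2]
    simpa using sq_sum_le_card_mul_sum_sq (s := (Finset.univ : Finset (Fin M)))
      (f := fun i => ‖dev t i‖)
  have hnt : 0 ≤ n t := norm_nonneg _
  calc ∑ i, ‖dev t i‖ ≤ √M * n t := le_of_sq_le_sq hcs (by positivity)
    _ ≤ √M * (β * (ψ * √M) * (k / (1 - k))) := by gcongr; exact hnb t ht
    _ = β * ψ * (√M * √M) * (k / (1 - k)) := by ring
    _ = _ := by rw [Real.mul_self_sqrt hM0.le]

/-- Uniform bound on the dual variables. -/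
lemma aux_lam {M d T : ℕ} (Et : Matrix (Fin M) (Fin M) ℝ) (hEnn : ∀ i j, 0 ≤ Et i j)
    (hErow : ∀ i, ∑ j, Et i j = 1)
    {β θ ψ : ℝ} (hβ : 0 < β) (hθ : 0 < θ) (hβθ : β * θ ≤ 1) (hψ : 0 ≤ ψ)
    (lam g : Fin M → ℕ → EuclideanSpace ℝ (Fin d))
    (hlam0 : ∀ i, lam i 0 = 0)
    (hg : ∀ i, ∀ t ≤ T, ‖g i t‖ ≤ ψ)
    (hstep : ∀ i, ∀ t ≤ T, lam i (t + 1) =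
      ∑ j, Et i j • (lam j t + β • (g j t - θ • lam j t))) :
    ∀ t ≤ T, ∀ i, ‖lam i t‖ ≤ ψ / θ := by
  intro t
  induction t with
  | zero => intro _ i; rw [hlam0]; simp; positivity
  | succ t ih =>
    intro ht i
    rw [hstep i t (by omega)]
    calc _ ≤ ∑ j, ‖Et i j • (lam j t + β • (g j t - θ • lam j t))‖ := norm_sum_le _ _
      _ ≤ ∑ j, Et i j * (ψ / θ) := by
        refine Finset.sum_le_sum fun j _ => ?_
        rw [norm_smul, Real.norm_eq_abs, abs_of_nonneg (hEnn i j)]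
        refine mul_le_mul_of_nonneg_left ?_ (hEnn i j)
        have e : lam j t + β • (g j t - θ • lam j t) = (1 - β * θ) • lam j t + β • g j t := by
          module
        rw [e]
        refine (norm_add_le _ _).trans ?_
        rw [norm_smul, norm_smul, Real.norm_eq_abs, Real.norm_eq_abs, abs_of_pos hβ,
          abs_of_nonneg (by linarith)]
        have h1 := ih (by omega) j
        have h2 := hg j t (by omega)
        have h0 : 0 ≤ 1 - β * θ := by linarith
        calc _ ≤ (1 - β * θ) * (ψ / θ) + β * ψ := by gcongr
          _ = ψ / θ := by field_simp; ring
      _ = ψ / θ := by rw [← Finset.sum_mul, hErow, one_mul]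

set_option maxHeartbeats 2000000 in
/-- **Accumulative constraint-violation bound for the attack-free decentralized online resource
allocation algorithm (Algorithm 1).** -/
theorem attack_free_constraint_violation_bound
    (d M T : ℕ) (hM : 1 ≤ M) (hT : 1 ≤ T)
    -- local constraint sets
    (Ω : Fin M → Set (EuclideanSpace ℝ (Fin d)))
    (hΩne : ∀ i, (Ω i).Nonempty)
    (hΩcomp : ∀ i, IsCompact (Ω i))
    (hΩconv : ∀ i, Convex ℝ (Ω i))
    (R : ℝ) (hR : ∀ i, ∀ x ∈ Ω i, ∀ y ∈ Ω i, ‖x - y‖ ≤ R)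
    -- cost functions and their gradients
    (C : Fin M → ℕ → EuclideanSpace ℝ (Fin d) → ℝ)
    (gradC : Fin M → ℕ → EuclideanSpace ℝ (Fin d) → EuclideanSpace ℝ (Fin d))
    (hCconv : ∀ i, ∀ t ≤ T, ConvexOn ℝ Set.univ (C i t))
    (hCgrad : ∀ i, ∀ t ≤ T, ∀ x, HasGradientAt (C i t) (gradC i t x) x)
    (φ : ℝ) (hφ : ∀ i, ∀ t ≤ T, ∀ x ∈ Ω i, ‖gradC i t x‖ ≤ φ)
    (F : ℝ) (hF : ∀ i, ∀ t ≤ T, ∀ x ∈ Ω i, |C i t x| ≤ F)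
    -- demands and local constraint functions
    (D : ℕ → EuclideanSpace ℝ (Fin d))
    (Gt : Fin M → ℕ → EuclideanSpace ℝ (Fin d) → EuclideanSpace ℝ (Fin d))
    (hGt : ∀ i t P, Gt i t P = (M : ℝ)⁻¹ • (P - D t))
    (ψt : ℝ) (hψt : ∀ i, ∀ t ≤ T, ∀ P ∈ Ω i, ‖Gt i t P‖ ≤ ψt)
    -- doubly stochastic weight matrix with spectral-gap condition
    (Et : Matrix (Fin M) (Fin M) ℝ)
    (hEnn : ∀ i j, 0 ≤ Et i j)
    (hErow : ∀ i, ∑ j, Et i j = 1)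
    (hEcol : ∀ j, ∑ i, Et i j = 1)
    (κt : ℝ)
    (hκt : κt = ‖LinearMap.toContinuousLinearMap
        (Matrix.toEuclideanLin (Et - Matrix.of fun _ _ => (M : ℝ)⁻¹))‖ ^ 2)
    (hκtlt : κt < 1)
    (εt : ℝ) (hεt : εt = 1 - κt)
    -- step sizes and regularization parameter
    (α β θ : ℝ) (hα : 0 < α) (hβ : 0 < β) (hθ : 0 < θ) (hβθ : β * θ ≤ 1)
    -- iterates of Algorithm 1
    (P lam lamhalf : Fin M → ℕ → EuclideanSpace ℝ (Fin d))
    (hP0 : ∀ i, P i 0 ∈ Ω i)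
    (hlam0 : ∀ i, lam i 0 = 0)
    (hPmem : ∀ i, ∀ t ≤ T, P i (t + 1) ∈ Ω i)
    (hPmin : ∀ i, ∀ t ≤ T, ∀ Q ∈ Ω i,
      ⟪P i (t + 1) - P i t, gradC i t (P i t) + (M : ℝ)⁻¹ • lam i t⟫
          + (1 / (2 * α)) * ‖P i (t + 1) - P i t‖ ^ 2
        ≤ ⟪Q - P i t, gradC i t (P i t) + (M : ℝ)⁻¹ • lam i t⟫
          + (1 / (2 * α)) * ‖Q - P i t‖ ^ 2)
    (hlamhalf : ∀ i, ∀ t ≤ T,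
      lamhalf i t = lam i t + β • (Gt i t (P i t) - θ • lam i t))
    (hlamstep : ∀ i, ∀ t ≤ T, lam i (t + 1) = ∑ j, Et i j • lamhalf j t)
    -- comparator sequence
    (Pstar : Fin M → ℕ → EuclideanSpace ℝ (Fin d))
    (hPstar : ∀ i, ∀ t ≤ T, Pstar i t ∈ Ω i)
    (hPstarG : ∀ t ∈ Finset.Icc 1 T, ∑ i, Gt i t (Pstar i t) = 0) :
    ‖∑ t ∈ Finset.Icc 1 T, ∑ i, Gt i t (P i t)‖ ^ 2
      ≤ (2 * (M : ℝ) * θ * (T : ℝ) + 2 * (M : ℝ) / β)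
        * ((R / α) * ∑ t ∈ Finset.Icc 1 T, ∑ i, ‖Pstar i t - Pstar i (t - 1)‖
          + (1 / (2 * α)) * ∑ i, ‖P i 1 - Pstar i 0‖ ^ 2
          + φ ^ 2 * (M : ℝ) * α * (T : ℝ)
          + (ψt ^ 2 / (M : ℝ)) * α * (T : ℝ) / θ ^ 2
          + (4 * ψt ^ 2 * (M : ℝ) / (εt * Real.sqrt εt) + 2 * ψt ^ 2 * (M : ℝ))
              * β * (T : ℝ)
          + 2 * (M : ℝ) * F * (T : ℝ)) := by
  have hM0 : (0 : ℝ) < M := by exact_mod_cast hM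
  have hT1 : (1 : ℝ) ≤ T := by exact_mod_cast hT
  have i0 : Fin M := ⟨0, hM⟩
  have hPm : ∀ i, ∀ t ≤ T + 1, P i t ∈ Ω i := by
    intro i t ht
    cases t with
    | zero => exact hP0 i
    | succ t => exact hPmem i t (by omega)
  have hψ0 : 0 ≤ ψt := (norm_nonneg _).trans (hψt i0 0 (by omega) _ (hP0 i0))
  obtain ⟨g, hgdef⟩ : ∃ g : Fin M → ℕ → EuclideanSpace ℝ (Fin d),
    g = fun i t => Gt i t (P i t) := ⟨_, rfl⟩
  have hgi : ∀ i t, Gt i t (P i t) = g i t := by intro i t; rw [hgdef]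
  have hg : ∀ i, ∀ t ≤ T, ‖g i t‖ ≤ ψt := by
    intro i t ht; rw [← hgi]; exact hψt i t ht _ (hPm i t (by omega))
  have hstep : ∀ i, ∀ t ≤ T, lam i (t + 1) =
      ∑ j, Et i j • (lam j t + β • (g j t - θ • lam j t)) := by
    intro i t ht
    rw [hlamstep i t ht]
    refine Finset.sum_congr rfl fun j _ => ?_
    rw [hlamhalf j t ht, hgi]
  obtain ⟨k, hk⟩ : ∃ k : ℝ, k = ‖LinearMap.toContinuousLinearMap
        (Matrix.toEuclideanLin (Et - Matrix.of fun _ _ => (M : ℝ)⁻¹))‖ := ⟨_, rfl⟩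
  rw [← hk] at hκt
  have hk0 : 0 ≤ k := hk ▸ norm_nonneg _
  have hk1 : k < 1 := by nlinarith
  have hcons := aux_cons hM Et hErow hEcol k hk hk1 hβ hθ hβθ hψ0 lam g hlam0 hg hstep
  have hlam := aux_lam Et hEnn hErow hβ hθ hβθ hψ0 lam g hlam0 hg hstep
  -- the constant
  have hε0 : 0 < εt := by linarith
  have hε1 : εt ≤ 1 := by rw [hεt, hκt]; nlinarith
  have hconst : k / (1 - k) + 2 ≤ 4 / (εt * Real.sqrt εt) := by
    have h1 : k / (1 - k) = k * (1 + k) / εt := by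
      rw [hεt, hκt, div_eq_div_iff (by linarith) (by nlinarith)]; ring
    have hs0 : 0 < Real.sqrt εt := Real.sqrt_pos.2 hε0
    have hs1 : Real.sqrt εt ≤ 1 := Real.sqrt_le_one.2 hε1
    have h2 : 4 / εt ≤ 4 / (εt * Real.sqrt εt) := by
      apply div_le_div_of_nonneg_left (by norm_num) (by positivity)
      nlinarith
    have h3 : k * (1 + k) / εt ≤ 2 / εt := by
      gcongr; nlinarith
    have h4 : 2 ≤ 2 / εt := by rw [le_div_iff₀ hε0]; linarith
    have h5 : 4 / εt = 2 / εt + 2 / εt := by ring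
    linarith
  -- primal per-step bound
  have hprimal : ∀ t ∈ Finset.Icc 1 T, ∑ i, ⟪g i t, lam i t⟫ ≤
      (R / α) * ∑ i, ‖Pstar i t - Pstar i (t - 1)‖
      + ((1 / (2 * α)) * ∑ i, ‖P i t - Pstar i (t - 1)‖ ^ 2
        - (1 / (2 * α)) * ∑ i, ‖P i (t + 1) - Pstar i (t + 1 - 1)‖ ^ 2)
      + φ ^ 2 * M * α + (ψt ^ 2 / M) * α / θ ^ 2 + 2 * M * F
      + ψt ^ 2 * M * β * (k / (1 - k)) := by
    intro t htm
    obtain ⟨ht1, htT⟩ := Finset.mem_Icc.1 htm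
    have hone : ∀ i, ⟪g i t, lam i t⟫ - ⟪Gt i t (Pstar i t), lam i t⟫ ≤
        (R / α) * ‖Pstar i t - Pstar i (t - 1)‖
        + ((1 / (2 * α)) * ‖P i t - Pstar i (t - 1)‖ ^ 2
          - (1 / (2 * α)) * ‖P i (t + 1) - Pstar i (t + 1 - 1)‖ ^ 2)
        + φ ^ 2 * α + (ψt ^ 2 / M ^ 2) * α / θ ^ 2 + 2 * F := by
      intro i
      have hp := aux_prox (hΩconv i) hα (hPm i (t + 1) (by omega)) (hPmin i t htT)
        (hPstar i t htT)
      have hc := aux_convex_grad (hCconv i t htT) (hCgrad i t htT (P i t)) (Pstar i t)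
      have hF1 := abs_le.1 (hF i t htT _ (hPm i t (by omega)))
      have hF2 := abs_le.1 (hF i t htT _ (hPstar i t htT))
      have hgd : ⟪P i t - Pstar i t, gradC i t (P i t)⟫
          = - ⟪Pstar i t - P i t, gradC i t (P i t)⟫ := by
        rw [← inner_neg_left, neg_sub]
      have hin : ⟪g i t, lam i t⟫ - ⟪Gt i t (Pstar i t), lam i t⟫
          = ⟪P i t - Pstar i t, (M : ℝ)⁻¹ • lam i t⟫ := by
        rw [← inner_sub_left, ← hgi, hGt, hGt, ← smul_sub, inner_smul_left, inner_smul_right]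
        simp
      have hu : ‖gradC i t (P i t) + (M : ℝ)⁻¹ • lam i t‖ ^ 2
          ≤ 2 * φ ^ 2 + 2 * (ψt ^ 2 / M ^ 2 / θ ^ 2) := by
        have h1 := hφ i t htT _ (hPm i t (by omega))
        have h2 := hlam t htT i
        have h3 : ‖(M : ℝ)⁻¹ • lam i t‖ ≤ ψt / M / θ := by
          rw [norm_smul, Real.norm_eq_abs, abs_of_pos (inv_pos.2 hM0)]
          calc (M : ℝ)⁻¹ * ‖lam i t‖ ≤ (M : ℝ)⁻¹ * (ψt / θ) := by gcongr
            _ = _ := by field_simp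
        have h4 := norm_add_le (gradC i t (P i t)) ((M : ℝ)⁻¹ • lam i t)
        calc _ ≤ (φ + ψt / M / θ) ^ 2 := by
              apply pow_le_pow_left₀ (norm_nonneg _); linarith
          _ ≤ 2 * φ ^ 2 + 2 * (ψt / M / θ) ^ 2 := by nlinarith [sq_nonneg (φ - ψt / M / θ)]
          _ = _ := by rw [div_pow, div_pow]
      have hu2 : α / 2 * ‖gradC i t (P i t) + (M : ℝ)⁻¹ • lam i t‖ ^ 2
          ≤ φ ^ 2 * α + (ψt ^ 2 / M ^ 2) * α / θ ^ 2 := by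
        calc _ ≤ α / 2 * (2 * φ ^ 2 + 2 * (ψt ^ 2 / M ^ 2 / θ ^ 2)) := by gcongr
          _ = _ := by ring
      have hpath : (1 / (2 * α)) * ‖P i t - Pstar i t‖ ^ 2 ≤
          (1 / (2 * α)) * ‖P i t - Pstar i (t - 1)‖ ^ 2
          + (R / α) * ‖Pstar i t - Pstar i (t - 1)‖ := by
        have ha := hR i _ (hPm i t (by omega)) _ (hPstar i t htT)
        have hb := hR i _ (hPm i t (by omega)) _ (hPstar i (t - 1) (by omega))
        have hc : ‖P i t - Pstar i t‖ ≤
            ‖P i t - Pstar i (t - 1)‖ + ‖Pstar i t - Pstar i (t - 1)‖ := by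
          have := norm_sub_le (P i t - Pstar i (t - 1)) (Pstar i t - Pstar i (t - 1))
          rwa [sub_sub_sub_cancel_right] at this
        have hd : ‖P i t - Pstar i t‖ ^ 2 ≤ ‖P i t - Pstar i (t - 1)‖ ^ 2
            + 2 * R * ‖Pstar i t - Pstar i (t - 1)‖ := by
          have n1 := norm_nonneg (P i t - Pstar i t)
          have n2 := norm_nonneg (P i t - Pstar i (t - 1))
          have n3 := norm_nonneg (Pstar i t - Pstar i (t - 1))
          nlinarith
        calc _ ≤ (1 / (2 * α)) * (‖P i t - Pstar i (t - 1)‖ ^ 2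
            + 2 * R * ‖Pstar i t - Pstar i (t - 1)‖) := by gcongr
          _ = _ := by field_simp
      rw [inner_add_right, hgd, ← hin, mul_sub] at hp
      rw [Nat.add_sub_cancel]
      linarith
    have hsum := Finset.sum_le_sum fun i (_ : i ∈ Finset.univ) => hone i
    simp only [Finset.sum_add_distrib, Finset.sum_sub_distrib, ← Finset.mul_sum,
      Finset.sum_const, Finset.card_univ, Fintype.card_fin, nsmul_eq_mul] at hsum
    have hz : ∑ i, ⟪Gt i t (Pstar i t), lam i t⟫ ≤ ψt ^ 2 * M * β * (k / (1 - k)) := by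
      have h1 : ∑ i, ⟪Gt i t (Pstar i t), lam i t⟫
          = ∑ i, ⟪Gt i t (Pstar i t), lam i t - (M : ℝ)⁻¹ • ∑ j, lam j t⟫ := by
        simp only [inner_sub_right, Finset.sum_sub_distrib]
        rw [← sum_inner, hPstarG t htm, inner_zero_left, sub_zero]
      rw [h1]
      calc _ ≤ ∑ i, ψt * ‖lam i t - (M : ℝ)⁻¹ • ∑ j, lam j t‖ := by
            refine Finset.sum_le_sum fun i _ => (real_inner_le_norm _ _).trans ?_
            gcongr
            exact hψt i t htT _ (hPstar i t htT)
        _ ≤ ψt * (β * ψt * M * (k / (1 - k))) := by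
            rw [← Finset.mul_sum]; gcongr; exact hcons t htT
        _ = _ := by ring
    have e1 : (M : ℝ) * (ψt ^ 2 / M ^ 2 * α / θ ^ 2) = ψt ^ 2 / M * α / θ ^ 2 := by field_simp
    rw [e1] at hsum
    linarith
  -- dual per-step bound
  have hdual : ∀ c : EuclideanSpace ℝ (Fin d), ∀ t ≤ T, ∑ i, ‖lam i (t + 1) - c‖ ^ 2 ≤
      ∑ i, ‖lam i t - c‖ ^ 2 + 2 * β * (∑ i, ⟪g i t, lam i t⟫ - ⟪∑ i, g i t, c⟫)
        + M * (β * θ * ‖c‖ ^ 2) + M * (4 * β ^ 2 * ψt ^ 2) := by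
    intro c t ht
    rw [Finset.sum_congr rfl fun i _ => by rw [hstep i t ht]]
    refine (aux_stoch Et hEnn hErow hEcol _ c).trans ?_
    refine (Finset.sum_le_sum fun i _ =>
      aux_dual hβ hθ (lam i t) (g i t) c (hg i t ht) (hlam t ht i)).trans (le_of_eq ?_)
    simp only [Finset.sum_add_distrib, ← Finset.mul_sum, inner_sub_left, Finset.sum_sub_distrib,
      sum_inner, Finset.sum_const, Finset.card_univ, Fintype.card_fin, nsmul_eq_mul]
    simp only [real_inner_comm]
    ring
  simp only [hgi]
  obtain ⟨S, hS⟩ : ∃ S, S = ∑ t ∈ Finset.Icc 1 T, ∑ i, g i t := ⟨_, rfl⟩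
  rw [← hS]
  have hSn : ‖S‖ ≤ M * T * ψt := by
    rw [hS]
    calc _ ≤ ∑ t ∈ Finset.Icc 1 T, ∑ i : Fin M, ψt := by
          refine norm_sum_le_of_le _ fun t ht => norm_sum_le_of_le _ fun i _ => ?_
          exact hg i t (Finset.mem_Icc.1 ht).2
      _ = _ := by simp; ring
  obtain ⟨K, hK⟩ : ∃ K : ℝ, K = θ * T + 1 / β := ⟨_, rfl⟩
  have hKβ : 1 / β ≤ K := by
    have : 0 ≤ θ * T := by positivity
    linarith
  have hK0 : 0 < K := lt_of_lt_of_le (by positivity) hKβ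
  obtain ⟨c, hc⟩ : ∃ c, c = (1 / (M * K)) • S := ⟨_, rfl⟩
  have hcn : ‖c‖ = ‖S‖ / (M * K) := by
    rw [hc, norm_smul, Real.norm_eq_abs, abs_of_pos (by positivity)]; ring
  have hSc : ⟪S, c⟫ = ‖S‖ ^ 2 / (M * K) := by
    rw [hc, inner_smul_right, real_inner_self_eq_norm_sq]; ring
  have hcb : ‖c‖ ≤ ψt * T * β := by
    rw [hcn, div_le_iff₀ (by positivity)]
    have h1 : 1 ≤ β * K := by rw [div_le_iff₀ hβ] at hKβ; linarith
    calc ‖S‖ ≤ M * T * ψt * 1 := by linarith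
      _ ≤ M * T * ψt * (β * K) := by gcongr
      _ = _ := by ring
  -- initial dual term
  have hV1 : ∑ i, ‖lam i 1 - c‖ ^ 2 ≤ M * (β ^ 2 * ψt ^ 2) + 2 * β * (M * ψt * ‖c‖)
      + M * ‖c‖ ^ 2 := by
    rw [Finset.sum_congr rfl fun i _ => by rw [hstep i 0 (by omega)]]
    refine (aux_stoch Et hEnn hErow hEcol _ c).trans ?_
    have : ∀ i ∈ (Finset.univ : Finset (Fin M)),
        ‖lam i 0 + β • (g i 0 - θ • lam i 0) - c‖ ^ 2 ≤ (β * ψt + ‖c‖) ^ 2 := by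
      intro i _
      apply pow_le_pow_left₀ (norm_nonneg _)
      rw [hlam0]
      simp only [smul_zero, sub_zero, zero_add]
      refine (norm_sub_le _ _).trans ?_
      rw [norm_smul, Real.norm_eq_abs, abs_of_pos hβ]
      gcongr
      exact hg i 0 (by omega)
    refine (Finset.sum_le_sum this).trans (le_of_eq ?_)
    simp
    ring
  -- combine per step
  have hcomb : ∀ t ∈ Finset.Icc 1 T, ⟪∑ i, g i t, c⟫ ≤
      (R / α) * ∑ i, ‖Pstar i t - Pstar i (t - 1)‖
      + ((1 / (2 * α)) * ∑ i, ‖P i t - Pstar i (t - 1)‖ ^ 2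
        - (1 / (2 * α)) * ∑ i, ‖P i (t + 1) - Pstar i (t + 1 - 1)‖ ^ 2)
      + ((1 / (2 * β)) * ∑ i, ‖lam i t - c‖ ^ 2
        - (1 / (2 * β)) * ∑ i, ‖lam i (t + 1) - c‖ ^ 2)
      + (φ ^ 2 * M * α + (ψt ^ 2 / M) * α / θ ^ 2 + 2 * M * F
      + ψt ^ 2 * M * β * (k / (1 - k)) + M * θ / 2 * ‖c‖ ^ 2 + 2 * M * β * ψt ^ 2) := by
    intro t ht
    have h1 := hprimal t ht
    have h2 := hdual c t (Finset.mem_Icc.1 ht).2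
    have h3 : (1 / (2 * β)) * ∑ i, ‖lam i (t + 1) - c‖ ^ 2 ≤
        (1 / (2 * β)) * ∑ i, ‖lam i t - c‖ ^ 2 + (∑ i, ⟪g i t, lam i t⟫ - ⟪∑ i, g i t, c⟫)
        + M * θ / 2 * ‖c‖ ^ 2 + 2 * M * β * ψt ^ 2 := by
      refine (mul_le_mul_of_nonneg_left h2 (by positivity)).trans (le_of_eq ?_)
      field_simp
      ring
    linarith
  have hsum := Finset.sum_le_sum hcomb
  rw [← sum_inner, ← hS, hSc] at hsum
  simp only [Finset.sum_add_distrib] at hsum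
  rw [aux_tel (fun t => (1 / (2 * α)) * ∑ i, ‖P i t - Pstar i (t - 1)‖ ^ 2),
    aux_tel (fun t => (1 / (2 * β)) * ∑ i, ‖lam i t - c‖ ^ 2), ← Finset.mul_sum] at hsum
  simp only [Finset.sum_const, Nat.card_Icc, nsmul_eq_mul, Nat.add_sub_cancel, Nat.sub_self] at hsum
  have hn1 : 0 ≤ (1 / (2 * α)) * ∑ i, ‖P i (T + 1) - Pstar i T‖ ^ 2 :=
    mul_nonneg (by positivity) (Finset.sum_nonneg fun _ _ => sq_nonneg _)
  have hn2 : 0 ≤ (1 / (2 * β)) * ∑ i, ‖lam i (T + 1) - c‖ ^ 2 :=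
    mul_nonneg (by positivity) (Finset.sum_nonneg fun _ _ => sq_nonneg _)
  have hV1' : (1 / (2 * β)) * ∑ i, ‖lam i 1 - c‖ ^ 2 ≤
      M * β * ψt ^ 2 / 2 + M * ψt ^ 2 * T * β + M * (1 / β) / 2 * ‖c‖ ^ 2 := by
    calc _ ≤ (1 / (2 * β)) * (M * (β ^ 2 * ψt ^ 2) + 2 * β * (M * ψt * (ψt * T * β))
          + M * ‖c‖ ^ 2) := by
          refine mul_le_mul_of_nonneg_left (hV1.trans ?_) (by positivity)
          gcongr
      _ = _ := by field_simp
  have hcq : (M * (1 / β) / 2 * ‖c‖ ^ 2 + T * (M * θ / 2 * ‖c‖ ^ 2))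
      = ‖S‖ ^ 2 / (M * K) / 2 := by
    have : (M * (1 / β) / 2 * ‖c‖ ^ 2 + T * (M * θ / 2 * ‖c‖ ^ 2)) = M * K / 2 * ‖c‖ ^ 2 := by
      rw [hK]; ring
    rw [this, hcn]; field_simp
  have hq0 : 0 ≤ ψt ^ 2 * M * β := by positivity
  have hconst2 : T * (ψt ^ 2 * M * β * (k / (1 - k))) + 2 * (T * (ψt ^ 2 * M * β))
      ≤ 4 * ψt ^ 2 * M / (εt * Real.sqrt εt) * β * T := by
    calc _ = (T * (ψt ^ 2 * M * β)) * (k / (1 - k) + 2) := by ring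
      _ ≤ (T * (ψt ^ 2 * M * β)) * (4 / (εt * Real.sqrt εt)) := by gcongr
      _ = _ := by ring
  have hTq : ψt ^ 2 * M * β ≤ T * (ψt ^ 2 * M * β) := le_mul_of_one_le_left hq0 hT1
  have hfac : 2 * (M : ℝ) * θ * T + 2 * M / β = 2 * (M * K) := by rw [hK]; ring
  rw [hfac]
  have hMK : 0 < (M : ℝ) * K := by positivity
  suffices h : ‖S‖ ^ 2 / (M * K) / 2 ≤ (R / α) * ∑ t ∈ Finset.Icc 1 T, ∑ i, ‖Pstar i t - Pstar i (t - 1)‖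
          + (1 / (2 * α)) * ∑ i, ‖P i 1 - Pstar i 0‖ ^ 2
          + φ ^ 2 * (M : ℝ) * α * (T : ℝ)
          + (ψt ^ 2 / (M : ℝ)) * α * (T : ℝ) / θ ^ 2
          + (4 * ψt ^ 2 * (M : ℝ) / (εt * Real.sqrt εt) + 2 * ψt ^ 2 * (M : ℝ))
              * β * (T : ℝ)
          + 2 * (M : ℝ) * F * (T : ℝ) by
    calc ‖S‖ ^ 2 = 2 * (M * K) * (‖S‖ ^ 2 / (M * K) / 2) := by field_simp
      _ ≤ _ := mul_le_mul_of_nonneg_left h (by positivity)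
  have e5 : (ψt ^ 2 / (M : ℝ)) * α * (T : ℝ) / θ ^ 2 = T * ((ψt ^ 2 / M) * α / θ ^ 2) := by ring
  rw [e5]
  linarith only [hsum, hn1, hn2, hV1', hcq, hconst2, hTq, hq0]
end

section
/- Under the above setup, for every comparator sequence (P_i^{t*}) with P_i^{t*} ∈ Ω_i for all benign i ∈ {1,…,H} and all t ∈ {0,…,T}, and with Σ_{i=1}^H G_i^t(P_i^{t*}) = 0 for every t ∈ {1,…,T}, the iterates of the Byzantine-resilient Algorithm 2 satisfy the dynamic-regret bound: Σ_{t=1}^T Σ_{i=1}^H [C_i^t(P_i^t) − C_i^t(P_i^{t*})] ≤ (R/α)·Σ_{t=1}^T Σ_{i=1}^H ‖P_i^{t*} − P_i^{(t−1)*}‖ + (1/(2α))·Σ_{i=1}^H ‖P_i^1 − P_i^{0*}‖² + φ²·H·α·T + (4H³ψ²/(ε^{3/2}M²) + H³ψ²/M² + ψ²H)·β·T + (Hψ²/M²)·α·T/θ² + (1 + 1/ε³)·(4ρH + χ)·(8H³ψ²/M²)·(T/θ). -/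
open scoped RealInnerProductSpace
open Finset

section helpers

set_option linter.unusedSectionVars false
set_option linter.unusedVariables false

variable {V : Type*} [NormedAddCommGroup V] [InnerProductSpace ℝ V] {H : ℕ}

/-- Frobenius norm of a stack of vectors. -/
noncomputable def Fn (x : Fin H → V) : ℝ := Real.sqrt (∑ i, ‖x i‖ ^ 2)

/-- Average of a stack of vectors. -/
noncomputable def vmean (x : Fin H → V) : V := (H : ℝ)⁻¹ • ∑ i, x i

/-- Centered stack of vectors. -/
noncomputable def cen (x : Fin H → V) : Fin H → V := fun i => x i - vmean x

lemma Fn_nonneg (x : Fin H → V) : 0 ≤ Fn x := Real.sqrt_nonneg _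

lemma Fn_sq (x : Fin H → V) : Fn x ^ 2 = ∑ i, ‖x i‖ ^ 2 :=
  Real.sq_sqrt (Finset.sum_nonneg fun i _ => by positivity)

lemma Fn_eq (x : Fin H → V) : Fn x = ‖(WithLp.toLp 2 x : PiLp 2 (fun _ : Fin H => V))‖ := by
  rw [PiLp.norm_eq_of_L2]; rfl

lemma Fn_add (x y : Fin H → V) : Fn (fun i => x i + y i) ≤ Fn x + Fn y := by
  rw [Fn_eq, Fn_eq, Fn_eq]
  exact norm_add_le (WithLp.toLp 2 x : PiLp 2 (fun _ : Fin H => V)) (WithLp.toLp 2 y)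

lemma Fn_smul (c : ℝ) (hc : 0 ≤ c) (x : Fin H → V) : Fn (fun i => c • x i) = c * Fn x := by
  unfold Fn
  simp only [norm_smul, mul_pow, ← Finset.mul_sum, Real.norm_eq_abs, sq_abs]
  rw [Real.sqrt_mul (by positivity), Real.sqrt_sq hc]

lemma Fn_le {x : Fin H → V} {b : ℝ} (hb : 0 ≤ b) (h : ∑ i, ‖x i‖ ^ 2 ≤ b ^ 2) : Fn x ≤ b :=
  Real.sqrt_le_iff.mpr ⟨hb, h⟩

lemma Fn_le_const {x : Fin H → V} {b : ℝ} (hb : 0 ≤ b) (h : ∀ i, ‖x i‖ ≤ b) :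
    Fn x ≤ b * Real.sqrt H := by
  apply Fn_le (by positivity)
  rw [mul_pow, Real.sq_sqrt (by positivity)]
  calc ∑ i, ‖x i‖ ^ 2 ≤ ∑ i : Fin H, b ^ 2 := by
        gcongr with i; exact h i
    _ = b ^ 2 * H := by simp [mul_comm]

lemma sum_norm_le (x : Fin H → V) : ∑ i, ‖x i‖ ≤ Real.sqrt H * Fn x := by
  refine abs_le_of_sq_le_sq' ?_ (by have := Fn_nonneg x; positivity) |>.2
  rw [mul_pow, Real.sq_sqrt (by positivity), Fn_sq]
  simpa using Finset.sum_mul_sq_le_sq_mul_sq Finset.univ (fun _ : Fin H => (1 : ℝ)) (fun i => ‖x i‖)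

lemma sum_cen (hH : 1 ≤ H) (x : Fin H → V) : ∑ i, cen x i = 0 := by
  have : (H : ℝ) ≠ 0 := by positivity
  simp [cen, vmean, Finset.sum_sub_distrib, ← Nat.cast_smul_eq_nsmul ℝ, smul_smul, this]

lemma Fn_cen_le (hH : 1 ≤ H) (x : Fin H → V) : Fn (cen x) ≤ Fn x := by
  apply Fn_le (Fn_nonneg _)
  rw [Fn_sq]
  have h : ∀ i, ‖x i‖ ^ 2 = ‖cen x i‖ ^ 2 + 2 * inner ℝ (cen x i) (vmean x) + ‖vmean x‖ ^ 2 := by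
    intro i
    rw [← norm_add_sq_real]; simp [cen]
  have h2 : ∑ i, ‖x i‖ ^ 2 = ∑ i, ‖cen x i‖ ^ 2 + 2 * inner ℝ (∑ i, cen x i) (vmean x)
      + H * ‖vmean x‖ ^ 2 := by
    rw [sum_inner, Finset.mul_sum, Finset.sum_congr rfl fun i _ => h i,
      Finset.sum_add_distrib, Finset.sum_add_distrib]
    simp
  rw [h2, sum_cen hH]
  simp; positivity

lemma cen_add (x y : Fin H → V) : cen (fun i => x i + y i) = fun i => cen x i + cen y i := by
  funext i; simp only [cen, vmean, Finset.sum_add_distrib, smul_add]; abel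

lemma cen_smul (c : ℝ) (x : Fin H → V) : cen (fun i => c • x i) = fun i => c • cen x i := by
  funext i; simp only [cen, vmean, ← Finset.smul_sum, smul_sub]; rw [smul_comm]

lemma Fn_mat {d : ℕ} (A : Matrix (Fin H) (Fin H) ℝ) (x : Fin H → EuclideanSpace ℝ (Fin d)) :
    Fn (fun i => ∑ j, A i j • x j)
      ≤ ‖LinearMap.toContinuousLinearMap (Matrix.toEuclideanLin A)‖ * Fn x := by
  set N := ‖LinearMap.toContinuousLinearMap (Matrix.toEuclideanLin A)‖
  apply Fn_le (mul_nonneg (norm_nonneg _) (Fn_nonneg _))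
  rw [mul_pow, Fn_sq]
  simp only [EuclideanSpace.norm_sq_eq]
  rw [Finset.sum_comm, Finset.sum_comm (f := fun j k => ‖(x j) k‖ ^ 2), Finset.mul_sum]
  apply Finset.sum_le_sum
  intro k _
  have := ContinuousLinearMap.le_opNorm (LinearMap.toContinuousLinearMap (Matrix.toEuclideanLin A))
    (WithLp.toLp 2 (fun j => x j k))
  have h2 := pow_le_pow_left₀ (norm_nonneg _) this 2
  rw [mul_pow, EuclideanSpace.norm_sq_eq, EuclideanSpace.norm_sq_eq] at h2
  simpa [Matrix.mulVec, dotProduct] using h2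

lemma sum_smul_sq (a : Fin H → ℝ) (x : Fin H → V) :
    ‖∑ i, a i • x i‖ ^ 2 ≤ (∑ i, a i ^ 2) * Fn x ^ 2 := by
  rw [Fn_sq]
  calc ‖∑ i, a i • x i‖ ^ 2 ≤ (∑ i, |a i| * ‖x i‖) ^ 2 := by
        gcongr
        refine (norm_sum_le _ _).trans (le_of_eq ?_)
        simp [norm_smul]
    _ ≤ (∑ i, |a i| ^ 2) * ∑ i, ‖x i‖ ^ 2 := Finset.sum_mul_sq_le_sq_mul_sq _ _ _
    _ = _ := by simp

lemma two_sq (a b : V) : ‖a + b‖ ^ 2 ≤ 2 * ‖a‖ ^ 2 + 2 * ‖b‖ ^ 2 := by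
  have := parallelogram_law_with_norm ℝ a b
  nlinarith [mul_self_nonneg ‖a - b‖]

/-- error of the aggregation -/
lemma agg_err (hH : 1 ≤ H) (E : Matrix (Fin H) (Fin H) ℝ) (hnn : ∀ i j, 0 ≤ E i j)
    (hrow : ∀ i, ∑ j, E i j = 1) (ρ : ℝ) (hρ : 0 ≤ ρ) (z w : Fin H → V)
    (h1 : ∀ i, ‖w i - ∑ j, E i j • z j‖ ^ 2 ≤ ρ * ∑ j, E i j * ‖z j - ∑ k, E i k • z k‖ ^ 2) :
    Fn (fun i => w i - ∑ j, E i j • z j) ^ 2 ≤ ρ * H * Fn (cen z) ^ 2 := by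
  rw [Fn_sq]
  have key : ∀ i, ‖w i - ∑ j, E i j • z j‖ ^ 2 ≤ ρ * Fn (cen z) ^ 2 := by
    intro i
    refine (h1 i).trans ?_
    gcongr
    rw [Fn_sq]
    set y := ∑ k, E i k • z k with hy
    have e1 : ∀ j, E i j * ‖z j - y‖ ^ 2 = E i j * ‖cen z j‖ ^ 2
        + 2 * inner ℝ (E i j • cen z j) (vmean z - y) + E i j * ‖vmean z - y‖ ^ 2 := by
      intro j
      have : z j - y = cen z j + (vmean z - y) := by simp [cen]
      rw [this, norm_add_sq_real, real_inner_smul_left]; ring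
    have e2 : ∑ j, E i j • cen z j = y - vmean z := by
      simp [cen, smul_sub, Finset.sum_sub_distrib, ← Finset.sum_smul, hrow, hy]
    have e3 : ∑ j, E i j * ‖z j - y‖ ^ 2 = ∑ j, E i j * ‖cen z j‖ ^ 2 - ‖vmean z - y‖ ^ 2 := by
      rw [Finset.sum_congr rfl fun j _ => e1 j, Finset.sum_add_distrib, Finset.sum_add_distrib,
        ← Finset.mul_sum, ← sum_inner, e2, ← Finset.sum_mul, hrow, ← neg_sub (vmean z) y,
        inner_neg_left, real_inner_self_eq_norm_sq]
      ring
    rw [e3]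
    have e4 : ∑ j, E i j * ‖cen z j‖ ^ 2 ≤ ∑ j, ‖cen z j‖ ^ 2 := by
      apply Finset.sum_le_sum
      intro j _
      have : E i j ≤ 1 := by
        rw [← hrow i]; exact Finset.single_le_sum (fun k _ => hnn i k) (Finset.mem_univ j)
      exact mul_le_of_le_one_left (by positivity) this
    nlinarith [sq_nonneg ‖vmean z - y‖]
  calc ∑ i, ‖w i - ∑ j, E i j • z j‖ ^ 2 ≤ ∑ i : Fin H, ρ * Fn (cen z) ^ 2 :=
        Finset.sum_le_sum fun i _ => key i
    _ = _ := by simp; ring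

lemma agg_mean (hH : 1 ≤ H) (E : Matrix (Fin H) (Fin H) ℝ) (hnn : ∀ i j, 0 ≤ E i j)
    (hrow : ∀ i, ∑ j, E i j = 1) (ρ : ℝ) (hρ : 0 ≤ ρ) (z w : Fin H → V)
    (χ : ℝ) (hχ : χ = (H : ℝ)⁻¹ * ∑ j, (∑ i, E i j - 1) ^ 2)
    (h1 : ∀ i, ‖w i - ∑ j, E i j • z j‖ ^ 2 ≤ ρ * ∑ j, E i j * ‖z j - ∑ k, E i k • z k‖ ^ 2) :
    H * ‖vmean w - vmean z‖ ^ 2 ≤ 2 * (ρ * H + χ) * Fn (cen z) ^ 2 := by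
  have hH0 : (0 : ℝ) < H := by positivity
  have herr := agg_err hH E hnn hrow ρ hρ z w h1
  set err := fun i => w i - ∑ j, E i j • z j with herrdef
  have hs : ∑ i, err i + ∑ j, (∑ i, E i j - 1) • cen z j = ∑ i, w i - ∑ i, z i := by
    have e0 : ∑ j, (∑ i, E i j - 1) • vmean z = 0 := by
      rw [← Finset.sum_smul, Finset.sum_sub_distrib, Finset.sum_comm]
      simp [hrow]
    have e1 : ∑ j, (∑ i, E i j - 1) • cen z j = ∑ j, (∑ i, E i j) • z j - ∑ j, z j := by
      simp only [cen, smul_sub]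
      rw [Finset.sum_sub_distrib, e0]
      simp [sub_smul, Finset.sum_sub_distrib]
    rw [e1, herrdef, Finset.sum_sub_distrib, Finset.sum_comm]
    simp [Finset.sum_smul]
  have hm : vmean w - vmean z = (H : ℝ)⁻¹ • (∑ i, err i + ∑ j, (∑ i, E i j - 1) • cen z j) := by
    rw [hs, vmean, vmean, smul_sub]
  rw [hm, norm_smul, mul_pow]
  have b1 : ‖∑ i, err i‖ ^ 2 ≤ H * Fn err ^ 2 := by
    simpa using sum_smul_sq (fun _ => (1 : ℝ)) err
  have b2 := sum_smul_sq (fun j => ∑ i, E i j - 1) (cen z)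
  have b3 : ∑ j, (∑ i, E i j - 1) ^ 2 = H * χ := by rw [hχ]; field_simp
  rw [b3] at b2
  have b4 := two_sq (∑ i, err i) (∑ j, (∑ i, E i j - 1) • cen z j)
  have b5 : ‖∑ i, err i + ∑ j, (∑ i, E i j - 1) • cen z j‖ ^ 2
      ≤ H * (2 * (ρ * H + χ) * Fn (cen z) ^ 2) := by
    have := mul_le_mul_of_nonneg_left herr hH0.le
    nlinarith
  have : (H : ℝ) * (‖(H : ℝ)⁻¹‖ ^ 2 * ‖∑ i, err i + ∑ j, (∑ i, E i j - 1) • cen z j‖ ^ 2)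
      = (H : ℝ)⁻¹ * ‖∑ i, err i + ∑ j, (∑ i, E i j - 1) • cen z j‖ ^ 2 := by
    rw [norm_inv, Real.norm_natCast]; field_simp
  rw [this, inv_mul_le_iff₀ hH0]
  exact b5

lemma agg_cen {d : ℕ} (hH : 1 ≤ H) (E : Matrix (Fin H) (Fin H) ℝ) (hnn : ∀ i j, 0 ≤ E i j)
    (hrow : ∀ i, ∑ j, E i j = 1) (ρ : ℝ) (hρ : 0 ≤ ρ) (z w : Fin H → EuclideanSpace ℝ (Fin d))
    (h1 : ∀ i, ‖w i - ∑ j, E i j • z j‖ ^ 2 ≤ ρ * ∑ j, E i j * ‖z j - ∑ k, E i k • z k‖ ^ 2) :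
    Fn (cen w) ≤ (‖LinearMap.toContinuousLinearMap (Matrix.toEuclideanLin
          (E - Matrix.of fun _ j => (H : ℝ)⁻¹ * ∑ k, E k j))‖ + Real.sqrt (ρ * H)) * Fn (cen z) := by
  have hH0 : (H : ℝ) ≠ 0 := by positivity
  have herr := agg_err hH E hnn hrow ρ hρ z w h1
  set A := E - Matrix.of fun _ j => (H : ℝ)⁻¹ * ∑ k, E k j with hA
  set err := fun i => w i - ∑ j, E i j • z j with herrdef
  have hAz : cen (fun i => ∑ j, E i j • z j) = fun i => ∑ j, A i j • cen z j := by
    funext i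
    have e0 : ∑ j, A i j • vmean z = 0 := by
      rw [← Finset.sum_smul]
      have : ∑ j, A i j = 0 := by
        simp only [hA, Matrix.sub_apply, Matrix.of_apply]
        rw [Finset.sum_sub_distrib, ← Finset.mul_sum, Finset.sum_comm]
        simp [hrow, hH0]
      rw [this, zero_smul]
    simp only [cen, smul_sub]
    rw [Finset.sum_sub_distrib, e0, sub_zero]
    simp only [hA, Matrix.sub_apply, Matrix.of_apply, sub_smul, vmean]
    rw [Finset.sum_sub_distrib, Finset.sum_comm]
    simp [Finset.sum_smul, Finset.smul_sum, mul_smul]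
  have hw : cen w = fun i => (∑ j, A i j • cen z j) + cen err i := by
    have : w = fun i => (∑ j, E i j • z j) + err i := by funext i; simp [herrdef]
    rw [this, cen_add, hAz]
  rw [hw, add_mul]
  refine (Fn_add _ _).trans (add_le_add (Fn_mat A _) ((Fn_cen_le hH err).trans ?_))
  refine abs_le_of_sq_le_sq' ?_ (by have := Fn_nonneg (cen z); positivity) |>.2
  rw [mul_pow, Real.sq_sqrt (by positivity)]
  exact herr

lemma three_sq (u r : V) : ‖u + r‖ ^ 2 ≤ 3 * ‖u‖ ^ 2 + 3 / 2 * ‖r‖ ^ 2 := by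
  have h1 := norm_add_sq_real u r
  have h2 := norm_sub_sq_real ((2 : ℝ) • u) r
  rw [norm_smul, real_inner_smul_left] at h2
  norm_num at h2
  nlinarith [sq_nonneg ‖(2 : ℝ) • u - r‖]

/-- one dual step -/
lemma dual_step (l u r : V) (b U r2 : ℝ) (hb0 : 0 < b) (hb1 : b < 1)
    (hu : ‖u‖ ^ 2 ≤ U) (hr : ‖r‖ ^ 2 ≤ r2) :
    -2 * inner ℝ l u ≤ ‖l‖ ^ 2 - ‖(1 - b) • l + u + r‖ ^ 2 + (4 * U + 2 * r2 / b) := by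
  obtain ⟨s, rfl⟩ : ∃ s : V, r = b • s := ⟨b⁻¹ • r, by rw [smul_smul, mul_inv_cancel₀ hb0.ne', one_smul]⟩
  have h1 : ‖(1 - b) • l + u + b • s‖ ^ 2 = (1 - b) ^ 2 * ‖l‖ ^ 2
      + 2 * (1 - b) * (inner ℝ l u + b * inner ℝ l s) + ‖u + b • s‖ ^ 2 := by
    rw [add_assoc, norm_add_sq_real, norm_smul, mul_pow, Real.norm_eq_abs, sq_abs,
      real_inner_smul_left, inner_add_right, real_inner_smul_right]
    ring
  have h2 := three_sq u (b • s)
  have h3 := norm_add_sq_real l u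
  have h4 := norm_sub_sq_real l s
  have hs : ‖b • s‖ ^ 2 = b ^ 2 * ‖s‖ ^ 2 := by
    rw [norm_smul, mul_pow, Real.norm_eq_abs, sq_abs]
  rw [hs] at hr h2
  have h5 : b * ‖s‖ ^ 2 ≤ r2 / b := by
    rw [le_div_iff₀ hb0]; nlinarith
  have h6 : 0 ≤ b * ‖l + u‖ ^ 2 := by positivity
  have h7 : 0 ≤ b * (1 - b) * ‖l - s‖ ^ 2 :=
    mul_nonneg (mul_nonneg hb0.le (by linarith)) (sq_nonneg _)
  rw [h3] at h6
  rw [h4] at h7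
  have h8 : b * ‖u‖ ^ 2 ≤ ‖u‖ ^ 2 := mul_le_of_le_one_left (by positivity) hb1.le
  have h9 : b * (b * ‖s‖ ^ 2) ≤ b * ‖s‖ ^ 2 := mul_le_of_le_one_left (by positivity) hb1.le
  have h10 : 2 * r2 / b = 2 * (r2 / b) := by ring
  rw [h1, h10]
  have : 0 ≤ b * ‖s‖ ^ 2 := by positivity
  nlinarith

lemma dual_init (u r : V) (b U r2 : ℝ) (hb0 : 0 < b) (hb1 : b < 1)
    (hu : ‖u‖ ^ 2 ≤ U) (hr : ‖r‖ ^ 2 ≤ r2) :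
    ‖u + r‖ ^ 2 ≤ 3 * U + 3 / 2 * (r2 / b) := by
  have h2 := three_sq u r
  have : ‖r‖ ^ 2 ≤ r2 / b := by
    rw [le_div_iff₀ hb0]
    have : ‖r‖ ^ 2 * b ≤ ‖r‖ ^ 2 := mul_le_of_le_one_right (by positivity) hb1.le
    linarith
  linarith

/-- prox inequality -/
lemma prox_step (S : Set V) (hS : Convex ℝ S) (α : ℝ) (hα : 0 < α) (p p' v : V) (hp' : p' ∈ S)
    (hmin : ∀ Q ∈ S, inner ℝ (p' - p) v + (1 / (2 * α)) * ‖p' - p‖ ^ 2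
      ≤ inner ℝ (Q - p) v + (1 / (2 * α)) * ‖Q - p‖ ^ 2) (Q : V) (hQ : Q ∈ S) :
    inner ℝ (p - Q) v ≤ (1 / (2 * α)) * (‖Q - p‖ ^ 2 - ‖Q - p'‖ ^ 2) + α / 2 * ‖v‖ ^ 2 := by
  have hc : (0 : ℝ) < 1 / (2 * α) := by positivity
  have hcα : (1 / (2 * α)) * α = 1 / 2 := by field_simp
  set c := 1 / (2 * α) with hcdef
  have key : ∀ τ : ℝ, 0 < τ → τ ≤ 1 →
      0 ≤ inner ℝ (Q - p') v + 2 * c * inner ℝ (p' - p) (Q - p') + τ * (c * ‖Q - p'‖ ^ 2) := by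
    intro τ h0 h1
    have hm : p' + τ • (Q - p') ∈ S := hS.add_smul_sub_mem hp' hQ ⟨h0.le, h1⟩
    have h := hmin _ hm
    have e : p' + τ • (Q - p') - p = (p' - p) + τ • (Q - p') := by abel
    rw [e, norm_add_sq_real, inner_add_left, real_inner_smul_left, real_inner_smul_right,
      norm_smul, mul_pow, Real.norm_eq_abs, sq_abs] at h
    have : 0 ≤ τ * (inner ℝ (Q - p') v + 2 * c * inner ℝ (p' - p) (Q - p')
        + τ * (c * ‖Q - p'‖ ^ 2)) := by nlinarith
    exact nonneg_of_mul_nonneg_right this h0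
  have h0 : 0 ≤ inner ℝ (Q - p') v + 2 * c * inner ℝ (p' - p) (Q - p') := by
    by_contra! hneg
    set A := inner ℝ (Q - p') v + 2 * c * inner ℝ (p' - p) (Q - p')
    set B := c * ‖Q - p'‖ ^ 2 with hB
    have hB0 : 0 ≤ B := by positivity
    have h1 := key (min 1 (-A / (2 * (B + 1)))) (by
      apply lt_min one_pos; apply div_pos <;> linarith) (min_le_left _ _)
    have h2 : min 1 (-A / (2 * (B + 1))) * B ≤ -A / (2 * (B + 1)) * B :=
      mul_le_mul_of_nonneg_right (min_le_right _ _) hB0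
    have h3 : -A / (2 * (B + 1)) * B ≤ -A / 2 := by
      rw [div_mul_eq_mul_div, div_le_div_iff₀ (by positivity) (by positivity)]
      nlinarith
    linarith
  have e1 : ‖Q - p‖ ^ 2 = ‖Q - p'‖ ^ 2 + 2 * inner ℝ (p' - p) (Q - p') + ‖p' - p‖ ^ 2 := by
    have : Q - p = (Q - p') + (p' - p) := by abel
    rw [this, norm_add_sq_real, real_inner_comm]
  have e2 : inner ℝ (p - Q) v = - inner ℝ (p' - p) v - inner ℝ (Q - p') v := by
    have : p - Q = -(p' - p) - (Q - p') := by abel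
    rw [this, inner_sub_left, inner_neg_left]
  have e3 : - inner ℝ (p' - p) v ≤ c * ‖p' - p‖ ^ 2 + α / 2 * ‖v‖ ^ 2 := by
    have h := norm_add_sq_real (p' - p) (α • v)
    rw [real_inner_smul_right, norm_smul, mul_pow, Real.norm_eq_abs, sq_abs] at h
    have h' : 0 ≤ c * ‖p' - p + α • v‖ ^ 2 := by positivity
    rw [h] at h'
    have : c * (‖p' - p‖ ^ 2 + 2 * (α * inner ℝ (p' - p) v) + α ^ 2 * ‖v‖ ^ 2)
      = c * ‖p' - p‖ ^ 2 + 2 * (c * α) * inner ℝ (p' - p) v + (c * α) * α * ‖v‖ ^ 2 := by ring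
    rw [this, hcα] at h'
    linarith
  rw [e1, e2]
  linarith

/-- first order convexity -/
lemma convex_grad [CompleteSpace V] (f : V → ℝ) (hf : ConvexOn ℝ Set.univ f) (x y g : V)
    (hg : HasGradientAt f g x) : f x - f y ≤ inner ℝ (x - y) g := by
  have hc : ConvexOn ℝ Set.univ (fun s : ℝ => f (AffineMap.lineMap x y s)) := by
    have h := hf.comp_affineMap (AffineMap.lineMap x y : ℝ →ᵃ[ℝ] V)
    rw [Set.preimage_univ] at h
    exact h
  have hd : HasDerivAt (fun s : ℝ => f (AffineMap.lineMap x y s)) (inner ℝ g (y - x)) 0 := by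
    have h1 : HasDerivAt (fun s : ℝ => (AffineMap.lineMap x y s : V)) (y - x) 0 :=
      AffineMap.hasDerivAt_lineMap
    have h2 : HasFDerivAt f (InnerProductSpace.toDual ℝ V g) (AffineMap.lineMap x y (0 : ℝ)) := by
      simpa using hg.hasFDerivAt
    have h := h2.comp_hasDerivAt (0 : ℝ) h1
    simp only [InnerProductSpace.toDual_apply_apply] at h
    exact h
  have := hc.le_slope_of_hasDerivAt (Set.mem_univ 0) (Set.mem_univ 1) one_pos hd
  simp [slope] at this
  rw [← neg_sub y x, inner_neg_left, real_inner_comm]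
  linarith

lemma tele (f : ℕ → ℝ) (n : ℕ) : ∑ t ∈ Finset.Icc 1 n, (f t - f (t + 1)) = f 1 - f (n + 1) := by
  induction n with
  | zero => simp
  | succ n ih => rw [Finset.sum_Icc_succ_top (by omega), ih]; ring

lemma path_tele (S : Set V) (R : ℝ) (hR : ∀ x ∈ S, ∀ y ∈ S, ‖x - y‖ ≤ R) (T : ℕ) (p q : ℕ → V)
    (hp : ∀ t ≤ T, p t ∈ S) (hq : ∀ t ≤ T, q t ∈ S) (n : ℕ) (hn : n ≤ T) :
    ∑ t ∈ Finset.Icc 1 n, (‖q t - p t‖ ^ 2 - ‖q t - p (t + 1)‖ ^ 2)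
      ≤ 2 * R * ∑ t ∈ Finset.Icc 1 n, ‖q t - q (t - 1)‖ + ‖p 1 - q 0‖ ^ 2
        - ‖q n - p (n + 1)‖ ^ 2 := by
  induction n with
  | zero => simp [norm_sub_rev]
  | succ n ih =>
    rw [Finset.sum_Icc_succ_top (by omega), Finset.sum_Icc_succ_top (by omega)]
    have h := ih (by omega)
    simp only [Nat.add_sub_cancel]
    have h1 : ‖q (n + 1) - p (n + 1)‖ ≤ ‖q (n + 1) - q n‖ + ‖q n - p (n + 1)‖ :=
      norm_sub_le_norm_sub_add_norm_sub _ _ _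
    have h2 := hR _ (hq (n + 1) hn) _ (hp (n + 1) hn)
    have h3 := hR _ (hq n (by omega)) _ (hp (n + 1) hn)
    have h4 : ‖q (n + 1) - p (n + 1)‖ ^ 2 - ‖q n - p (n + 1)‖ ^ 2
        ≤ 2 * R * ‖q (n + 1) - q n‖ := by
      have : 0 ≤ ‖q (n + 1) - q n‖ := norm_nonneg _
      have : 0 ≤ ‖q n - p (n + 1)‖ := norm_nonneg _
      have : 0 ≤ ‖q (n + 1) - p (n + 1)‖ := norm_nonneg _
      nlinarith
    nlinarith

/-- dual inner product bound -/
lemma dual_inner (hH : 1 ≤ H) (gs g l : Fin H → V) (c A β Y : ℝ) (hβ : 0 < β) (hc : 0 ≤ c)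
    (hgs : ∀ i, ‖gs i‖ ≤ c) (hg : ∀ i, ‖g i‖ ≤ c) (hsum : ∑ i, gs i = 0)
    (hl : Fn (cen l) ≤ A) (hY : -2 * inner ℝ (vmean l) (β • vmean g) ≤ Y) :
    ∑ i, inner ℝ (gs i - g i) (l i) ≤ 2 * (c * Real.sqrt H) * A + H / (2 * β) * Y := by
  have hH0 : (0 : ℝ) < H := by positivity
  have e1 : ∀ i, inner ℝ (gs i - g i) (l i) = inner ℝ (gs i - g i) (cen l i)
      + inner ℝ (gs i - g i) (vmean l) := by
    intro i; rw [← inner_add_right]; simp [cen]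
  rw [Finset.sum_congr rfl fun i _ => e1 i, Finset.sum_add_distrib, ← sum_inner,
    Finset.sum_sub_distrib, hsum, zero_sub, inner_neg_left]
  have e2 : ∑ i, g i = (H : ℝ) • vmean g := by
    rw [vmean, smul_smul, mul_inv_cancel₀ hH0.ne', one_smul]
  rw [e2, real_inner_smul_left]
  have h1 : ∑ i, inner ℝ (gs i - g i) (cen l i) ≤ 2 * (c * Real.sqrt H) * A := by
    calc ∑ i, inner ℝ (gs i - g i) (cen l i) ≤ ∑ i, (2 * c) * ‖cen l i‖ := by
          apply Finset.sum_le_sum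
          intro i _
          refine (real_inner_le_norm _ _).trans ?_
          gcongr
          refine (norm_sub_le _ _).trans ?_
          linarith [hgs i, hg i]
      _ = 2 * c * ∑ i, ‖cen l i‖ := by rw [Finset.mul_sum]
      _ ≤ 2 * c * (Real.sqrt H * A) := by
          gcongr
          exact (sum_norm_le _).trans (by gcongr)
      _ = _ := by ring
  rw [real_inner_smul_right] at hY
  have h2 : -(H * inner ℝ (vmean g) (vmean l)) ≤ H / (2 * β) * Y := by
    have : H / (2 * β) * (-2 * (β * inner ℝ (vmean l) (vmean g)))
        = -(H * inner ℝ (vmean g) (vmean l)) := by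
      rw [real_inner_comm]; field_simp
    rw [← this]
    gcongr
  linarith

lemma vmean_norm_le (hH : 1 ≤ H) (x : Fin H → V) (c : ℝ) (h : ∀ i, ‖x i‖ ≤ c) : ‖vmean x‖ ≤ c := by
  have hH0 : (0 : ℝ) < H := by positivity
  rw [vmean, norm_smul, norm_inv, Real.norm_natCast, inv_mul_le_iff₀ hH0]
  refine (norm_sum_le _ _).trans ?_
  refine (Finset.sum_le_sum fun i _ => h i).trans ?_
  simp

lemma vmean_comb (a b : ℝ) (x y : Fin H → V) :
    vmean (fun i => a • x i + b • y i) = a • vmean x + b • vmean y := by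
  simp only [vmean, Finset.sum_add_distrib, ← Finset.smul_sum, smul_add]
  rw [smul_comm, smul_comm b]

lemma final_arith (h M ψ ε ρ χ β θ T : ℝ) (hh : 1 ≤ h) (hM : h ≤ M) (hψ : 0 ≤ ψ) (hε : 0 < ε)
    (hε1 : ε ≤ 1) (hρ : 0 ≤ ρ) (hχ : 0 ≤ χ) (hβ : 0 < β) (hθ : 0 < θ) (hT : 1 ≤ T)
    (K U r2 : ℝ) (hK : K ^ 2 = h ^ 3 * ψ ^ 2 / M ^ 2) (hU : h * U = β ^ 2 * K ^ 2)
    (hr2 : h * r2 = 2 * (ρ * h + χ) * (2 / ε * (β * K)) ^ 2) (hU0 : 0 ≤ U) (hr20 : 0 ≤ r2) :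
    T * (2 * K * ((2 / ε - 1) * (β * K)))
      + h / (2 * β) * (3 * U + 3 / 2 * (r2 / (β * θ)) + T * (4 * U + 2 * r2 / (β * θ)))
    ≤ (4 * h ^ 3 * ψ ^ 2 / (ε * Real.sqrt ε * M ^ 2) + h ^ 3 * ψ ^ 2 / M ^ 2 + ψ ^ 2 * h) * β * T
      + (1 + 1 / ε ^ 3) * (4 * ρ * h + χ) * (8 * h ^ 3 * ψ ^ 2 / M ^ 2) * (T / θ) := by
  have hM0 : 0 < M := by linarith
  have h0 : 0 < h := by linarith
  have hse : 0 < Real.sqrt ε := Real.sqrt_pos.mpr hε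
  have hse1 : Real.sqrt ε ≤ 1 := by simpa using Real.sqrt_le_sqrt hε1
  have e1 : 4 * h ^ 3 * ψ ^ 2 / (ε * Real.sqrt ε * M ^ 2) = 4 * K ^ 2 / (ε * Real.sqrt ε) := by
    rw [hK]; field_simp
  have e2 : 8 * h ^ 3 * ψ ^ 2 / M ^ 2 = 8 * K ^ 2 := by rw [hK]; ring
  have e3 : K ^ 2 ≤ ψ ^ 2 * h := by
    rw [hK, div_le_iff₀ (by positivity)]
    have : h ^ 2 ≤ M ^ 2 := by gcongr
    have h2 := mul_le_mul_of_nonneg_left this (by positivity : 0 ≤ ψ ^ 2 * h)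
    linarith
  have e4 : 4 * K ^ 2 / ε ≤ 4 * K ^ 2 / (ε * Real.sqrt ε) := by
    apply div_le_div_of_nonneg_left (by positivity) (by positivity)
    exact mul_le_of_le_one_right hε.le hse1
  rw [e1, e2, ← hK]
  have b1 : h / (2 * β) * (3 * U + 3 / 2 * (r2 / (β * θ)) + T * (4 * U + 2 * r2 / (β * θ)))
      ≤ h / (2 * β) * (T * (7 * U + 7 / 2 * (r2 / (β * θ)))) := by
    have hx : 0 ≤ r2 / (β * θ) := by positivity
    have : 2 * r2 / (β * θ) = 2 * (r2 / (β * θ)) := by ring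
    rw [this]
    gcongr
    nlinarith
  have b2 : h / (2 * β) * (T * (7 * U + 7 / 2 * (r2 / (β * θ))))
      = T * (7 / 2 * β * K ^ 2) + T / θ * (14 * (ρ * h + χ) * K ^ 2 / ε ^ 2) := by
    have : h / (2 * β) * (T * (7 * U + 7 / 2 * (r2 / (β * θ))))
      = T / (2 * β) * (7 * (h * U) + 7 / 2 * (h * r2 / (β * θ))) := by ring
    rw [this, hU, hr2]
    field_simp
    ring
  have b3 : 14 * (ρ * h + χ) * K ^ 2 / ε ^ 2
      ≤ (1 + 1 / ε ^ 3) * (4 * ρ * h + χ) * (8 * K ^ 2) := by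
    have c1 : 14 / ε ^ 2 ≤ 8 * (1 + 1 / ε ^ 3) := by
      have : 8 * (1 + 1 / ε ^ 3) = (8 * ε ^ 3 + 8) / ε ^ 3 := by field_simp
      rw [this, div_le_div_iff₀ (by positivity) (by positivity)]
      have c0 : 14 * ε ≤ 8 * ε ^ 3 + 8 := by
        nlinarith [mul_nonneg hε.le (sq_nonneg (ε - 3 / 4)), sq_nonneg (ε - 3 / 4)]
      have := mul_le_mul_of_nonneg_left c0 (by positivity : 0 ≤ ε ^ 2)
      linarith
    calc 14 * (ρ * h + χ) * K ^ 2 / ε ^ 2 = 14 / ε ^ 2 * ((ρ * h + χ) * K ^ 2) := by ring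
      _ ≤ 8 * (1 + 1 / ε ^ 3) * ((4 * ρ * h + χ) * K ^ 2) := by
          gcongr
          nlinarith
      _ = _ := by ring
  have b4 := mul_le_mul_of_nonneg_left b3 (by positivity : 0 ≤ T / θ)
  have b5 : T * (2 * K * ((2 / ε - 1) * (β * K))) + T * (7 / 2 * β * K ^ 2)
      ≤ (4 * K ^ 2 / (ε * Real.sqrt ε) + K ^ 2 + ψ ^ 2 * h) * β * T := by
    have : T * (2 * K * ((2 / ε - 1) * (β * K))) + T * (7 / 2 * β * K ^ 2)
      = (4 * K ^ 2 / ε + 3 / 2 * K ^ 2) * β * T := by ring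
    rw [this]
    refine mul_le_mul_of_nonneg_right (mul_le_mul_of_nonneg_right ?_ hβ.le) (by linarith)
    nlinarith [sq_nonneg K]
  linarith

end helpers

set_option maxHeartbeats 2000000

/-- **Dynamic-regret bound for the Byzantine-resilient decentralized online
resource allocation algorithm (Algorithm 2, Theorem 2, regret part).** -/
theorem byzantine_resilient_dynamic_regret_bound
    (d H M T : ℕ) (hH : 1 ≤ H) (hHM : H ≤ M) (hT : 1 ≤ T)
    -- local constraint sets of the benign agents
    (Ω : Fin H → Set (EuclideanSpace ℝ (Fin d)))
    (hΩne : ∀ i, (Ω i).Nonempty)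
    (hΩcomp : ∀ i, IsCompact (Ω i))
    (hΩconv : ∀ i, Convex ℝ (Ω i))
    (R : ℝ) (hR : ∀ i, ∀ x ∈ Ω i, ∀ y ∈ Ω i, ‖x - y‖ ≤ R)
    -- cost functions and their gradients
    (C : Fin H → ℕ → EuclideanSpace ℝ (Fin d) → ℝ)
    (gradC : Fin H → ℕ → EuclideanSpace ℝ (Fin d) → EuclideanSpace ℝ (Fin d))
    (hCconv : ∀ i, ∀ t ≤ T, ConvexOn ℝ Set.univ (C i t))
    (hCgrad : ∀ i, ∀ t ≤ T, ∀ x, HasGradientAt (C i t) (gradC i t x) x)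
    (φ : ℝ) (hφ : ∀ i, ∀ t ≤ T, ∀ x ∈ Ω i, ‖gradC i t x‖ ≤ φ)
    -- demands and local constraint functions
    (D : ℕ → EuclideanSpace ℝ (Fin d))
    (G : Fin H → ℕ → EuclideanSpace ℝ (Fin d) → EuclideanSpace ℝ (Fin d))
    (hG : ∀ i t P, G i t P = (H : ℝ)⁻¹ • (P - D t))
    (ψ : ℝ) (hψ : ∀ i, ∀ t ≤ T, ∀ P ∈ Ω i, ‖G i t P‖ ≤ ψ)
    -- row-stochastic virtual weight matrix, its contraction data
    (Emat : Matrix (Fin H) (Fin H) ℝ)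
    (hEnn : ∀ i j, 0 ≤ Emat i j)
    (hErow : ∀ i, ∑ j, Emat i j = 1)
    (κ : ℝ)
    (hκ : κ = ‖LinearMap.toContinuousLinearMap
        (Matrix.toEuclideanLin
          (Emat - Matrix.of fun _ j => (H : ℝ)⁻¹ * ∑ k, Emat k j))‖ ^ 2)
    (hκlt : κ < 1)
    (χ : ℝ) (hχ : χ = (H : ℝ)⁻¹ * ∑ j, (∑ i, Emat i j - 1) ^ 2)
    (ρ : ℝ) (hρ : 0 ≤ ρ) (hρκ : 8 * Real.sqrt (ρ * H) < 1 - κ)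
    (ε : ℝ) (hε : ε = 1 - κ - 8 * Real.sqrt (ρ * H))
    -- step sizes and regularization parameter
    (α β θ : ℝ) (hα : 0 < α) (hβ : 0 < β) (hθ : 0 < θ)
    (hβθ0 : 0 < β * θ) (hβθ : β * θ < 1)
    -- iterates of Algorithm 2 (benign agents)
    (P lam lamhalf : Fin H → ℕ → EuclideanSpace ℝ (Fin d))
    (hP0 : ∀ i, P i 0 ∈ Ω i)
    (hlam0 : ∀ i, lam i 0 = 0)
    (hPmem : ∀ i, ∀ t ≤ T, P i (t + 1) ∈ Ω i)
    (hPmin : ∀ i, ∀ t ≤ T, ∀ Q ∈ Ω i,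
      ⟪P i (t + 1) - P i t, gradC i t (P i t) + (M : ℝ)⁻¹ • lam i t⟫
          + (1 / (2 * α)) * ‖P i (t + 1) - P i t‖ ^ 2
        ≤ ⟪Q - P i t, gradC i t (P i t) + (M : ℝ)⁻¹ • lam i t⟫
          + (1 / (2 * α)) * ‖Q - P i t‖ ^ 2)
    (hlamhalf : ∀ i, ∀ t ≤ T,
      lamhalf i t
        = lam i t + β • (((H : ℝ) / M) • G i t (P i t) - θ • lam i t))
    -- Property 1: contraction of the robust aggregation step
    (hProp1 : ∀ i, ∀ t ≤ T,
      ‖lam i (t + 1) - ∑ j, Emat i j • lamhalf j t‖ ^ 2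
        ≤ ρ * ∑ j, Emat i j
            * ‖lamhalf j t - ∑ k, Emat i k • lamhalf k t‖ ^ 2)
    -- Property 2: norm bound of the robust aggregation step
    (hProp2 : ∀ i, ∀ t ≤ T,
      ‖lam i (t + 1)‖
        ≤ sSup {r : ℝ | ∃ j, 0 < Emat i j ∧ r = ‖lamhalf j t‖})
    -- comparator sequence
    (Pstar : Fin H → ℕ → EuclideanSpace ℝ (Fin d))
    (hPstar : ∀ i, ∀ t ≤ T, Pstar i t ∈ Ω i)
    (hPstarG : ∀ t ∈ Finset.Icc 1 T, ∑ i, G i t (Pstar i t) = 0) :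
    ∑ t ∈ Finset.Icc 1 T, ∑ i, (C i t (P i t) - C i t (Pstar i t))
      ≤ (R / α) * ∑ t ∈ Finset.Icc 1 T, ∑ i, ‖Pstar i t - Pstar i (t - 1)‖
        + (1 / (2 * α)) * ∑ i, ‖P i 1 - Pstar i 0‖ ^ 2
        + φ ^ 2 * (H : ℝ) * α * (T : ℝ)
        + (4 * (H : ℝ) ^ 3 * ψ ^ 2 / (ε * Real.sqrt ε * (M : ℝ) ^ 2)
            + (H : ℝ) ^ 3 * ψ ^ 2 / (M : ℝ) ^ 2 + ψ ^ 2 * (H : ℝ))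
          * β * (T : ℝ)
        + ((H : ℝ) * ψ ^ 2 / (M : ℝ) ^ 2) * α * (T : ℝ) / θ ^ 2
        + (1 + 1 / ε ^ 3) * (4 * ρ * (H : ℝ) + χ)
            * (8 * (H : ℝ) ^ 3 * ψ ^ 2 / (M : ℝ) ^ 2) * ((T : ℝ) / θ) := by
  have hH0 : (0 : ℝ) < H := by exact_mod_cast hH
  have hHM' : (H : ℝ) ≤ M := by exact_mod_cast hHM
  have hM0 : (0 : ℝ) < M := by linarith
  have hH1 : (1 : ℝ) ≤ H := by exact_mod_cast hH
  have hT1 : (1 : ℝ) ≤ T := by exact_mod_cast hT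
  have i0 : Fin H := ⟨0, hH⟩
  have hPm : ∀ i, ∀ t ≤ T, P i t ∈ Ω i := by
    intro i t ht
    cases t with
    | zero => exact hP0 i
    | succ n => exact hPmem i n (by omega)
  have hψ0 : 0 ≤ ψ := (norm_nonneg _).trans (hψ i0 0 (by omega) _ (hP0 i0))
  have hχ0 : 0 ≤ χ := by rw [hχ]; positivity
  -- scaled constraint values
  set c : ℝ := (H : ℝ) / M * ψ with hc
  have hc0 : 0 ≤ c := by positivity
  set K : ℝ := c * Real.sqrt H with hKdef
  have hK0 : 0 ≤ K := by positivity
  have hgt : ∀ i, ∀ t ≤ T, ∀ Q ∈ Ω i, ‖((H : ℝ) / M) • G i t Q‖ ≤ c := by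
    intro i t ht Q hQ
    rw [norm_smul, Real.norm_of_nonneg (by positivity)]
    have := hψ i t ht Q hQ
    rw [hc]; gcongr
  have hhalf : ∀ i, ∀ t ≤ T, lamhalf i t
      = (1 - β * θ) • lam i t + β • (((H : ℝ) / M) • G i t (P i t)) := by
    intro i t ht
    rw [hlamhalf i t ht, smul_sub, sub_smul, one_smul, mul_smul]; abel
  -- bound on dual variables
  have hL : ∀ t ≤ T, ∀ i, ‖lam i t‖ ≤ c / θ := by
    intro t
    induction t with
    | zero => intro _ i; rw [hlam0, norm_zero]; positivity
    | succ n ih =>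
      intro hn i
      refine (hProp2 i n (by omega)).trans (Real.sSup_le ?_ (by positivity))
      rintro r ⟨j, _, rfl⟩
      rw [hhalf j n (by omega)]
      refine (norm_add_le _ _).trans ?_
      rw [norm_smul, norm_smul β, Real.norm_of_nonneg hβ.le,
        Real.norm_of_nonneg (by linarith : (0 : ℝ) ≤ 1 - β * θ)]
      have h1 := mul_le_mul_of_nonneg_left (ih (by omega) j) (by linarith : (0 : ℝ) ≤ 1 - β * θ)
      have h2 := mul_le_mul_of_nonneg_left (hgt j n (by omega) _ (hPm j n (by omega))) hβ.le
      have h3 : (1 - β * θ) * (c / θ) + β * c = c / θ := by field_simp; ring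
      linarith
  -- contraction constants
  set N := ‖LinearMap.toContinuousLinearMap (Matrix.toEuclideanLin
          (Emat - Matrix.of fun _ j => (H : ℝ)⁻¹ * ∑ k, Emat k j))‖ with hN
  have hN0 : 0 ≤ N := norm_nonneg _
  have hs0 : 0 ≤ Real.sqrt (ρ * H) := Real.sqrt_nonneg _
  have hε0 : 0 < ε := by rw [hε]; linarith
  have hε1 : ε ≤ 1 := by rw [hε, hκ]; nlinarith
  have hσ : N + Real.sqrt (ρ * H) ≤ 1 - ε / 2 := by
    rw [hε, hκ]; nlinarith [sq_nonneg (N - 1)]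
  have hcenhalf : ∀ t ≤ T, Fn (cen (fun i => lam i t)) ≤ (2 / ε - 1) * (β * K) →
      Fn (cen (fun i => lamhalf i t)) ≤ 2 / ε * (β * K) := by
    intro t ht h
    have e : (fun i => lamhalf i t) = fun i => (1 - β * θ) • lam i t
        + β • (((H : ℝ) / M) • G i t (P i t)) := funext fun i => hhalf i t ht
    rw [e, cen_add]
    refine (Fn_add _ _).trans ?_
    rw [cen_smul, cen_smul, Fn_smul _ (by linarith), Fn_smul _ hβ.le]
    have h1 : Fn (cen fun i => ((H : ℝ) / M) • G i t (P i t)) ≤ K :=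
      (Fn_cen_le hH _).trans (Fn_le_const hc0 fun i => hgt i t ht _ (hPm i t ht))
    have h2 := mul_le_mul_of_nonneg_left h1 hβ.le
    have h3 : (1 - β * θ) * Fn (cen fun i => lam i t) ≤ Fn (cen fun i => lam i t) :=
      mul_le_of_le_one_left (Fn_nonneg _) (by linarith)
    linarith
  have hcen : ∀ t ≤ T, Fn (cen (fun i => lam i t)) ≤ (2 / ε - 1) * (β * K) := by
    intro t
    induction t with
    | zero =>
      intro _
      have : Fn (cen (fun i => lam i 0)) = 0 := by simp [hlam0, cen, vmean, Fn]
      rw [this]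
      have : 1 ≤ 2 / ε := by rw [le_div_iff₀ hε0]; linarith
      have : 0 ≤ 2 / ε - 1 := by linarith
      positivity
    | succ n ih =>
      intro hn
      have h1 := agg_cen hH Emat hEnn hErow ρ hρ (fun i => lamhalf i n) (fun i => lam i (n + 1))
        (fun i => hProp1 i n (by omega))
      have h2 := hcenhalf n (by omega) (ih (by omega))
      refine h1.trans ?_
      calc _ ≤ (1 - ε / 2) * (2 / ε * (β * K)) :=
            mul_le_mul hσ h2 (Fn_nonneg _) (by linarith)
        _ = _ := by field_simp
  -- mean dynamics
  set m : ℕ → EuclideanSpace ℝ (Fin d) := fun t => vmean (fun i => lam i t) with hm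
  set vg : ℕ → EuclideanSpace ℝ (Fin d) :=
    fun t => vmean (fun i => ((H : ℝ) / M) • G i t (P i t)) with hvg
  set r : ℕ → EuclideanSpace ℝ (Fin d) :=
    fun t => m (t + 1) - vmean (fun i => lamhalf i t) with hr
  have hmean : ∀ t ≤ T, m (t + 1) = (1 - β * θ) • m t + β • vg t + r t := by
    intro t ht
    have e : (fun i => lamhalf i t) = fun i => (1 - β * θ) • lam i t
        + β • (((H : ℝ) / M) • G i t (P i t)) := funext fun i => hhalf i t ht
    have e2 : vmean (fun i => lamhalf i t) = (1 - β * θ) • m t + β • vg t := by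
      rw [e, vmean_comb]
    rw [← e2, hr]; simp
  set U : ℝ := β ^ 2 * c ^ 2 with hU
  set r2 : ℝ := (H : ℝ)⁻¹ * (2 * (ρ * H + χ) * (2 / ε * (β * K)) ^ 2) with hr2
  have hub : ∀ t ≤ T, ‖β • vg t‖ ^ 2 ≤ U := by
    intro t ht
    rw [norm_smul, mul_pow, Real.norm_of_nonneg hβ.le, hU]
    have := vmean_norm_le hH (fun i => ((H : ℝ) / M) • G i t (P i t)) c
      (fun i => hgt i t ht _ (hPm i t ht))
    gcongr
  have hrb : ∀ t ≤ T, ‖r t‖ ^ 2 ≤ r2 := by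
    intro t ht
    have h1 := agg_mean hH Emat hEnn hErow ρ hρ (fun i => lamhalf i t) (fun i => lam i (t + 1))
      χ hχ (fun i => hProp1 i t ht)
    have h2 := hcenhalf t ht (hcen t ht)
    have h3 := Fn_nonneg (cen fun i => lamhalf i t)
    rw [hr2, le_inv_mul_iff₀ hH0]
    refine h1.trans ?_
    gcongr
  have hm1 : ‖m 1‖ ^ 2 ≤ 3 * U + 3 / 2 * (r2 / (β * θ)) := by
    have h0 : m 0 = 0 := by simp [hm, vmean, hlam0]
    have h1 := hmean 0 (by omega)
    rw [h0, smul_zero, zero_add] at h1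
    rw [zero_add] at h1
    rw [h1]
    exact dual_init _ _ _ _ _ hβθ0 hβθ (hub 0 (by omega)) (hrb 0 (by omega))
  set c2 := 1 / (2 * α) with hc2
  have hc20 : 0 < c2 := by positivity
  -- per-step inequality
  have hstep : ∀ t ∈ Finset.Icc 1 T, ∑ i, (C i t (P i t) - C i t (Pstar i t))
      ≤ c2 * ∑ i, (‖Pstar i t - P i t‖ ^ 2 - ‖Pstar i t - P i (t + 1)‖ ^ 2)
        + (φ ^ 2 * H * α + (H * ψ ^ 2 / (M : ℝ) ^ 2) * α / θ ^ 2)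
        + (2 * K * ((2 / ε - 1) * (β * K))
        + H / (2 * β) * (‖m t‖ ^ 2 - ‖m (t + 1)‖ ^ 2 + (4 * U + 2 * r2 / (β * θ)))) := by
    intro t htm
    have ht : t ≤ T := (Finset.mem_Icc.mp htm).2
    have hd := dual_inner hH (fun i => ((H : ℝ) / M) • G i t (Pstar i t))
      (fun i => ((H : ℝ) / M) • G i t (P i t)) (fun i => lam i t) c ((2 / ε - 1) * (β * K)) β
      (‖m t‖ ^ 2 - ‖m (t + 1)‖ ^ 2 + (4 * U + 2 * r2 / (β * θ))) hβ hc0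
      (fun i => hgt i t ht _ (hPstar i t ht)) (fun i => hgt i t ht _ (hPm i t ht))
      (by rw [← Finset.smul_sum, hPstarG t htm, smul_zero]) (hcen t ht)
      (by
        rw [hmean t ht]
        exact dual_step _ _ _ _ _ _ hβθ0 hβθ (hub t ht) (hrb t ht))
    refine le_trans ?_ (add_le_add_right hd _)
    have hi : ∀ i, C i t (P i t) - C i t (Pstar i t)
        ≤ c2 * (‖Pstar i t - P i t‖ ^ 2 - ‖Pstar i t - P i (t + 1)‖ ^ 2)
          + (φ ^ 2 * α + (ψ ^ 2 / (M : ℝ) ^ 2) * α / θ ^ 2)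
          + inner ℝ (((H : ℝ) / M) • G i t (Pstar i t) - ((H : ℝ) / M) • G i t (P i t))
            (lam i t) := by
      intro i
      have h1 := convex_grad (C i t) (hCconv i t ht) (P i t) (Pstar i t) _ (hCgrad i t ht (P i t))
      have h2 := prox_step (Ω i) (hΩconv i) α hα (P i t) (P i (t + 1)) _ (hPmem i t ht)
        (hPmin i t ht) (Pstar i t) (hPstar i t ht)
      rw [inner_add_right, real_inner_smul_right] at h2
      have h3 : inner ℝ (((H : ℝ) / M) • G i t (Pstar i t) - ((H : ℝ) / M) • G i t (P i t))
            (lam i t) = - ((M : ℝ)⁻¹ * inner ℝ (P i t - Pstar i t) (lam i t)) := by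
        have : ((H : ℝ) / M) • G i t (Pstar i t) - ((H : ℝ) / M) • G i t (P i t)
            = -((M : ℝ)⁻¹ • (P i t - Pstar i t)) := by
          rw [hG, hG, ← smul_sub, ← smul_sub, smul_smul, ← smul_neg]
          congr 1
          · field_simp
          · abel
        rw [this, inner_neg_left, real_inner_smul_left]
      have h4 : ‖gradC i t (P i t) + (M : ℝ)⁻¹ • lam i t‖ ^ 2
          ≤ 2 * φ ^ 2 + 2 * (ψ ^ 2 / (M : ℝ) ^ 2 / θ ^ 2) := by
        refine (two_sq _ _).trans ?_
        have h5 : ‖gradC i t (P i t)‖ ^ 2 ≤ φ ^ 2 :=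
          pow_le_pow_left₀ (norm_nonneg _) (hφ i t ht _ (hPm i t ht)) 2
        have h6 : ‖(M : ℝ)⁻¹ • lam i t‖ ≤ ψ / M / θ := by
          rw [norm_smul, norm_inv, Real.norm_natCast]
          have h7 : c ≤ ψ := by
            rw [hc]; exact mul_le_of_le_one_left hψ0 (by rw [div_le_one hM0]; exact hHM')
          calc (M : ℝ)⁻¹ * ‖lam i t‖ ≤ (M : ℝ)⁻¹ * (c / θ) := by
                gcongr; exact hL t ht i
            _ ≤ (M : ℝ)⁻¹ * (ψ / θ) := by gcongr
            _ = _ := by ring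
        have h8 := pow_le_pow_left₀ (norm_nonneg _) h6 2
        rw [div_pow, div_pow] at h8
        linarith
      have h9 := mul_le_mul_of_nonneg_left h4 (by positivity : 0 ≤ α / 2)
      have h10 : α / 2 * (2 * φ ^ 2 + 2 * (ψ ^ 2 / (M : ℝ) ^ 2 / θ ^ 2))
        = φ ^ 2 * α + (ψ ^ 2 / (M : ℝ) ^ 2) * α / θ ^ 2 := by ring
      rw [h3]
      linarith
    refine (Finset.sum_le_sum fun i _ => hi i).trans (le_of_eq ?_)
    rw [Finset.sum_add_distrib, Finset.sum_add_distrib, ← Finset.mul_sum]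
    simp only [Finset.sum_const, Finset.card_univ, Fintype.card_fin, nsmul_eq_mul]
    ring
  have hsum := Finset.sum_le_sum hstep
  refine hsum.trans ?_
  have htele := tele (fun t => ‖m t‖ ^ 2) T
  simp only [Finset.sum_add_distrib, ← Finset.mul_sum, Finset.sum_const, Nat.card_Icc,
    nsmul_eq_mul, Nat.add_sub_cancel, htele]
  have hpath : ∑ t ∈ Finset.Icc 1 T, ∑ i,
        (‖Pstar i t - P i t‖ ^ 2 - ‖Pstar i t - P i (t + 1)‖ ^ 2)
      ≤ 2 * R * ∑ t ∈ Finset.Icc 1 T, ∑ i, ‖Pstar i t - Pstar i (t - 1)‖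
        + ∑ i, ‖P i 1 - Pstar i 0‖ ^ 2 := by
    rw [Finset.sum_comm, Finset.sum_comm (s := Finset.Icc 1 T)
      (f := fun t i => ‖Pstar i t - Pstar i (t - 1)‖), Finset.mul_sum, ← Finset.sum_add_distrib]
    apply Finset.sum_le_sum
    intro i _
    have := path_tele (Ω i) R (hR i) T (P i) (Pstar i) (hPm i) (hPstar i) T le_rfl
    linarith [sq_nonneg ‖Pstar i T - P i (T + 1)‖]
  have hpath2 := mul_le_mul_of_nonneg_left hpath hc20.le
  have hc2R : ∀ X : ℝ, c2 * (2 * R * X) = R / α * X := by intro X; rw [hc2]; field_simp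
  rw [mul_add, hc2R] at hpath2
  have hr20 : 0 ≤ r2 := by positivity
  have hU0 : 0 ≤ U := by positivity
  have hKsq : K ^ 2 = (H : ℝ) ^ 3 * ψ ^ 2 / (M : ℝ) ^ 2 := by
    rw [hKdef, mul_pow, Real.sq_sqrt hH0.le, hc]; field_simp
  have hfin := final_arith H M ψ ε ρ χ β θ T hH1 hHM' hψ0 hε0 hε1 hρ hχ0 hβ hθ hT1 K U r2 hKsq
    (by rw [hU, hKdef, mul_pow c (Real.sqrt H), Real.sq_sqrt hH0.le]; ring)
    (by rw [hr2]; field_simp) hU0 hr20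
  have hHb : (0 : ℝ) ≤ H / (2 * β) := by positivity
  have hlast : H / (2 * β) * (‖m 1‖ ^ 2 - ‖m (T + 1)‖ ^ 2 + T * (4 * U + 2 * r2 / (β * θ)))
      ≤ H / (2 * β) * (3 * U + 3 / 2 * (r2 / (β * θ)) + T * (4 * U + 2 * r2 / (β * θ))) := by
    gcongr
    linarith [sq_nonneg ‖m (T + 1)‖]
  have hA : φ ^ 2 * (H : ℝ) * α * T + H * ψ ^ 2 / (M : ℝ) ^ 2 * α * T / θ ^ 2
    = T * (φ ^ 2 * H * α) + T * (H * ψ ^ 2 / (M : ℝ) ^ 2 * α / θ ^ 2) := by ring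
  linarith
end

section
/- Under the above setup, additionally assuming |C_i^t(x)| ≤ F for all x ∈ Ω_i and 2H > M, for every comparator sequence (P_i^{t*}) with P_i^{t*} ∈ Ω_i for all benign i ∈ {1,…,H} and all t ∈ {0,…,T}, and with Σ_{i=1}^H G_i^t(P_i^{t*}) = 0 for every t ∈ {1,…,T}, the iterates of the Byzantine-resilient Algorithm 2 satisfy the accumulative constraint-violation bound: ‖Σ_{t=1}^T Σ_{i=1}^H G_i^t(P_i^t)‖² ≤ (M/(2H − M))·(2HθT + 2H/β)·[ (R/α)·Σ_{t=1}^T Σ_{i=1}^H ‖P_i^{t*} − P_i^{(t−1)*}‖ + (1/(2α))·Σ_{i=1}^H ‖P_i^1 − P_i^{0*}‖² + φ²·H·α·T + (Hψ²/M²)·α·T/θ² + (4H³ψ²/(ε^{3/2}M²) + H³ψ²/M² + ψ²H)·β·T + 2HF·T + (1 + 1/ε³)·(4ρH + χ)·(8H³ψ²/M²)·(T/θ) ]. -/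
open scoped RealInnerProductSpace
open Finset

theorem bz_prox {V : Type*} [NormedAddCommGroup V] [InnerProductSpace ℝ V]
    (Ω : Set V) (hΩ : Convex ℝ Ω) (α : ℝ) (hα : 0 < α) (p x v : V) (hp : p ∈ Ω)
    (hmin : ∀ Q ∈ Ω, ⟪p - x, v⟫ + (1 / (2 * α)) * ‖p - x‖ ^ 2
      ≤ ⟪Q - x, v⟫ + (1 / (2 * α)) * ‖Q - x‖ ^ 2) (q : V) (hq : q ∈ Ω) :
    ⟪x - q, v⟫ ≤ (1 / (2 * α)) * (‖x - q‖ ^ 2 - ‖p - q‖ ^ 2) + α / 2 * ‖v‖ ^ 2 := by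
  have key : 0 ≤ ⟪q - p, v⟫ + (1 / α) * ⟪p - x, q - p⟫ := by
    have h1 : ∀ s : ℝ, 0 < s → s ≤ 1 →
        0 ≤ (⟪q - p, v⟫ + (1 / α) * ⟪p - x, q - p⟫) + s * ((1 / (2 * α)) * ‖q - p‖ ^ 2) := by
      intro s hs hs1
      have hmem : p + s • (q - p) ∈ Ω := hΩ.add_smul_sub_mem hp hq ⟨hs.le, hs1⟩
      have h := hmin _ hmem
      have e1 : p + s • (q - p) - x = (p - x) + s • (q - p) := by abel
      rw [e1, norm_add_sq_real, inner_add_left, inner_smul_left, inner_smul_right, norm_smul,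
        mul_pow, Real.norm_eq_abs, sq_abs] at h
      simp only [conj_trivial] at h
      have h2 : 0 ≤ s * ((⟪q - p, v⟫ + (1 / α) * ⟪p - x, q - p⟫)
          + s * ((1 / (2 * α)) * ‖q - p‖ ^ 2)) := by
        have : s * ((⟪q - p, v⟫ + (1 / α) * ⟪p - x, q - p⟫)
          + s * ((1 / (2 * α)) * ‖q - p‖ ^ 2)) =
          s * ⟪q - p, v⟫ + 1 / (2 * α) * (2 * (s * ⟪p - x, q - p⟫) + s ^ 2 * ‖q - p‖ ^ 2) := by
          field_simp
          ring
        rw [this]; linarith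
      exact nonneg_of_mul_nonneg_right h2 hs
    by_contra hneg
    push Not at hneg
    set X := ⟪q - p, v⟫ + (1 / α) * ⟪p - x, q - p⟫ with hX
    set Y := (1 / (2 * α)) * ‖q - p‖ ^ 2 with hY
    have hY0 : 0 ≤ Y := by positivity
    have hs : 0 < min 1 (-X / (2 * (Y + 1))) := by
      apply lt_min one_pos
      apply div_pos <;> linarith
    have h2 := h1 _ hs (min_le_left _ _)
    have h3 : min 1 (-X / (2 * (Y + 1))) * Y ≤ (-X / (2 * (Y + 1))) * (Y + 1) :=
      mul_le_mul (min_le_right _ _) (by linarith) hY0 (by apply div_nonneg <;> linarith)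
    have h4 : (-X / (2 * (Y + 1))) * (Y + 1) = -X / 2 := by field_simp
    linarith
  have e2 : ‖x - q‖ ^ 2 = ‖p - x‖ ^ 2 + 2 * ⟪p - x, q - p⟫ + ‖p - q‖ ^ 2 := by
    rw [norm_sub_rev x q, norm_sub_rev p q, show q - x = (p - x) + (q - p) by abel,
      norm_add_sq_real]
  have e3 : ⟪x - q, v⟫ = - ⟪p - x, v⟫ - ⟪q - p, v⟫ := by
    rw [show x - q = -(p - x) - (q - p) by abel, inner_sub_left, inner_neg_left]
  have e4 : 0 ≤ ‖p - x + α • v‖ ^ 2 := by positivity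
  rw [norm_add_sq_real, inner_smul_right, norm_smul, mul_pow, Real.norm_eq_abs, sq_abs] at e4
  have e5 : 0 ≤ (1 / (2 * α)) * (‖p - x‖ ^ 2 + 2 * (α * ⟪p - x, v⟫) + α ^ 2 * ‖v‖ ^ 2) := by
    positivity
  have e6 : (1 / (2 * α)) * (‖p - x‖ ^ 2 + 2 * (α * ⟪p - x, v⟫) + α ^ 2 * ‖v‖ ^ 2)
      = (1 / (2 * α)) * ‖p - x‖ ^ 2 + ⟪p - x, v⟫ + α / 2 * ‖v‖ ^ 2 := by
    field_simp
  rw [e2, e3]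
  have e7 : 1 / (2 * α) * (‖p - x‖ ^ 2 + 2 * ⟪p - x, q - p⟫ + ‖p - q‖ ^ 2 - ‖p - q‖ ^ 2)
    = 1 / (2 * α) * ‖p - x‖ ^ 2 + (1 / α) * ⟪p - x, q - p⟫ := by
    field_simp; ring
  rw [e7]
  linarith

theorem bz_grad {V : Type*} [NormedAddCommGroup V] [InnerProductSpace ℝ V] [CompleteSpace V]
    (C : V → ℝ) (hC : ConvexOn ℝ Set.univ C) (x g q : V) (hg : HasGradientAt C g x) :
    C x - C q ≤ ⟪x - q, g⟫ := by
  have h1 : ConvexOn ℝ Set.univ (fun s : ℝ => C (AffineMap.lineMap x q s)) := by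
    have := hC.comp_affineMap (AffineMap.lineMap x q : ℝ →ᵃ[ℝ] V)
    simpa [Function.comp_def] using this
  have h2 : HasDerivAt (fun s : ℝ => C (AffineMap.lineMap x q s)) ⟪g, q - x⟫ 0 := by
    have hl : HasDerivAt (fun s : ℝ => (AffineMap.lineMap x q s : V)) (q - x) 0 :=
      AffineMap.hasDerivAt_lineMap
    have hf : HasFDerivAt C (InnerProductSpace.toDual ℝ V g) (AffineMap.lineMap x q (0 : ℝ)) := by
      simpa using hg.hasFDerivAt
    have := hf.comp_hasDerivAt (0 : ℝ) hl
    simpa [Function.comp_def] using this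
  have h3 := h1.le_slope_of_hasDerivAt (Set.mem_univ 0) (Set.mem_univ 1) one_pos h2
  simp [slope_def_field] at h3
  rw [show x - q = -(q - x) by abel, inner_neg_left, real_inner_comm]
  linarith

noncomputable def bzAvg {H : ℕ} {V : Type*} [NormedAddCommGroup V] [InnerProductSpace ℝ V]
    (v : Fin H → V) : V := (H : ℝ)⁻¹ • ∑ i, v i

noncomputable def bzN {H : ℕ} {V : Type*} [NormedAddCommGroup V] [InnerProductSpace ℝ V]
    (v : Fin H → V) : ℝ := ‖(WithLp.toLp 2 v : PiLp 2 (fun _ : Fin H => V))‖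

section
variable {H : ℕ} {V : Type*} [NormedAddCommGroup V] [InnerProductSpace ℝ V]

theorem bzN_nonneg (v : Fin H → V) : 0 ≤ bzN v := norm_nonneg _

theorem bzN_sq (v : Fin H → V) : bzN v ^ 2 = ∑ i, ‖v i‖ ^ 2 := by
  unfold bzN
  rw [PiLp.norm_sq_eq_of_L2]

theorem bzN_add (v w : Fin H → V) : bzN (v + w) ≤ bzN v + bzN w := by
  unfold bzN
  rw [WithLp.toLp_add]
  exact norm_add_le _ _

theorem bzN_smul (c : ℝ) (v : Fin H → V) : bzN (c • v) = |c| * bzN v := by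
  unfold bzN
  rw [WithLp.toLp_smul, norm_smul, Real.norm_eq_abs]

theorem bzN_le {v : Fin H → V} {c : ℝ} (hc : 0 ≤ c) (h : ∑ i, ‖v i‖ ^ 2 ≤ c ^ 2) :
    bzN v ≤ c := by
  rw [← bzN_sq] at h
  exact (sq_le_sq₀ (bzN_nonneg v) hc).1 h

/-- variance decomposition -/
theorem bz_var (w : Fin H → ℝ) (hw : ∑ j, w j = 1) (v : Fin H → V) (c : V) :
    ∑ j, w j * ‖v j - c‖ ^ 2 =
      ∑ j, w j * ‖v j - ∑ k, w k • v k‖ ^ 2 + ‖∑ k, w k • v k - c‖ ^ 2 := by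
  set m := ∑ k, w k • v k with hm
  have h0 : ∑ j, w j * ⟪v j - m, m - c⟫ = 0 := by
    have : ∑ j, w j * ⟪v j - m, m - c⟫ = ⟪∑ j, w j • (v j - m), m - c⟫ := by
      rw [sum_inner]; simp [inner_smul_left]
    rw [this]
    simp [smul_sub, ← hm, ← Finset.sum_smul, hw]
  have h1 : ∀ j, w j * ‖v j - c‖ ^ 2 =
      w j * ‖v j - m‖ ^ 2 + 2 * (w j * ⟪v j - m, m - c⟫) + w j * ‖m - c‖ ^ 2 := by
    intro j
    rw [show v j - c = (v j - m) + (m - c) by abel, norm_add_sq_real]; ring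
  simp_rw [h1]
  rw [Finset.sum_add_distrib, Finset.sum_add_distrib, ← Finset.mul_sum, h0, ← Finset.sum_mul, hw]
  ring

theorem bzAvg_eq (v : Fin H → V) : bzAvg v = ∑ k, (H : ℝ)⁻¹ • v k := by
  unfold bzAvg; rw [Finset.smul_sum]

theorem bz_sum_inv (hH : 1 ≤ H) : ∑ _j : Fin H, (H : ℝ)⁻¹ = 1 := by
  have : (H : ℝ) ≠ 0 := by positivity
  simp [this]

theorem bz_sum_sub_avg (hH : 1 ≤ H) (v : Fin H → V) : ∑ i, (v i - bzAvg v) = 0 := by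
  have : (H : ℝ) ≠ 0 := by positivity
  simp [bzAvg, ← Nat.cast_smul_eq_nsmul ℝ, smul_smul, this]

theorem bz_var_avg (hH : 1 ≤ H) (v : Fin H → V) :
    ∑ j, ‖v j‖ ^ 2 = ∑ j, ‖v j - bzAvg v‖ ^ 2 + H * ‖bzAvg v‖ ^ 2 := by
  have hH' : (H : ℝ) ≠ 0 := by positivity
  have h := bz_var (fun _ => (H : ℝ)⁻¹) (bz_sum_inv hH) v 0
  rw [← bzAvg_eq, ← Finset.mul_sum, ← Finset.mul_sum] at h
  simp only [sub_zero] at h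
  field_simp at h
  linarith

theorem bzN_center (hH : 1 ≤ H) (v : Fin H → V) : bzN (fun i => v i - bzAvg v) ≤ bzN v := by
  apply bzN_le (bzN_nonneg v)
  rw [bzN_sq, bz_var_avg hH v]
  have : 0 ≤ (H : ℝ) * ‖bzAvg v‖ ^ 2 := by positivity
  linarith

theorem bz_avg_sq (hH : 1 ≤ H) (v : Fin H → V) : H * ‖bzAvg v‖ ^ 2 ≤ ∑ j, ‖v j‖ ^ 2 := by
  rw [bz_var_avg hH v]
  have : 0 ≤ ∑ j, ‖v j - bzAvg v‖ ^ 2 := by positivity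
  linarith

theorem bz_avg_norm (hH : 1 ≤ H) (v : Fin H → V) (c : ℝ) (h : ∀ i, ‖v i‖ ≤ c) :
    ‖bzAvg v‖ ≤ c := by
  have hH' : (0 : ℝ) < H := by positivity
  unfold bzAvg
  rw [norm_smul, norm_inv, Real.norm_natCast, inv_mul_le_iff₀ hH']
  calc _ ≤ ∑ i, ‖v i‖ := norm_sum_le _ _
    _ ≤ ∑ _i : Fin H, c := Finset.sum_le_sum fun i _ => h i
    _ = _ := by simp

theorem bz_cs (c : Fin H → ℝ) (v : Fin H → V) :
    ‖∑ j, c j • v j‖ ^ 2 ≤ (∑ j, c j ^ 2) * ∑ j, ‖v j‖ ^ 2 := by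
  have h1 : ‖∑ j, c j • v j‖ ≤ ∑ j, |c j| * ‖v j‖ := by
    refine (norm_sum_le _ _).trans (le_of_eq ?_)
    simp [norm_smul]
  have h2 := Finset.sum_mul_sq_le_sq_mul_sq Finset.univ (fun j => |c j|) (fun j => ‖v j‖)
  simp only [sq_abs] at h2
  refine le_trans ?_ h2
  gcongr

theorem bz_l1 (v : Fin H → V) : ∑ j, ‖v j‖ ≤ Real.sqrt H * bzN v := by
  have h2 := Finset.sum_mul_sq_le_sq_mul_sq Finset.univ (fun _ : Fin H => (1:ℝ)) (fun j => ‖v j‖)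
  simp only [one_mul, one_pow, sum_const, card_univ, Fintype.card_fin, nsmul_eq_mul, mul_one] at h2
  rw [← bzN_sq] at h2
  refine (sq_le_sq₀ (by positivity) (mul_nonneg (by positivity) (bzN_nonneg v))).1 ?_
  rw [mul_pow, Real.sq_sqrt (by positivity)]
  exact h2

end

theorem bz_frob {H d : ℕ} (A : Matrix (Fin H) (Fin H) ℝ) (v : Fin H → EuclideanSpace ℝ (Fin d)) :
    bzN (fun i => ∑ j, A i j • v j) ≤
      ‖LinearMap.toContinuousLinearMap (Matrix.toEuclideanLin A)‖ * bzN v := by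
  set a := ‖LinearMap.toContinuousLinearMap (Matrix.toEuclideanLin A)‖ with ha
  have ha0 : 0 ≤ a := norm_nonneg _
  apply bzN_le (mul_nonneg ha0 (bzN_nonneg v))
  rw [mul_pow, bzN_sq]
  simp_rw [EuclideanSpace.norm_sq_eq]
  rw [Finset.sum_comm, Finset.sum_comm (γ := Fin H), Finset.mul_sum]
  apply Finset.sum_le_sum
  intro k _
  have h := (LinearMap.toContinuousLinearMap (Matrix.toEuclideanLin A)).le_opNorm
    (WithLp.toLp 2 (fun j => v j k))
  rw [← ha] at h
  have h2 := pow_le_pow_left₀ (norm_nonneg _) h 2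
  rw [mul_pow, EuclideanSpace.norm_sq_eq, EuclideanSpace.norm_sq_eq] at h2
  simpa [Matrix.toLpLin_apply, Matrix.mulVec, dotProduct] using h2

section
variable {H d : ℕ} 

theorem bz_e_le_one (Emat : Matrix (Fin H) (Fin H) ℝ)
    (hEnn : ∀ i j, 0 ≤ Emat i j) (hErow : ∀ i, ∑ j, Emat i j = 1) (i j : Fin H) :
    Emat i j ≤ 1 := by
  rw [← hErow i]
  exact Finset.single_le_sum (fun k _ => hEnn i k) (Finset.mem_univ j)

theorem bz_Delta (Emat : Matrix (Fin H) (Fin H) ℝ)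
    (hEnn : ∀ i j, 0 ≤ Emat i j) (hErow : ∀ i, ∑ j, Emat i j = 1)
    (ρ : ℝ) (hρ : 0 ≤ ρ) (w l : Fin H → EuclideanSpace ℝ (Fin d))
    (hP : ∀ i, ‖l i - ∑ j, Emat i j • w j‖ ^ 2
        ≤ ρ * ∑ j, Emat i j * ‖w j - ∑ k, Emat i k • w k‖ ^ 2) :
    ∑ i, ‖l i - ∑ j, Emat i j • w j‖ ^ 2 ≤ ρ * H * bzN (fun i => w i - bzAvg w) ^ 2 := by
  have h1 : ∀ i, ‖l i - ∑ j, Emat i j • w j‖ ^ 2 ≤ ρ * bzN (fun i => w i - bzAvg w) ^ 2 := by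
    intro i
    refine (hP i).trans ?_
    gcongr
    have h := bz_var (fun j => Emat i j) (hErow i) w (bzAvg w)
    have h3 : ∑ j, Emat i j * ‖w j - bzAvg w‖ ^ 2 ≤ bzN (fun i => w i - bzAvg w) ^ 2 := by
      rw [bzN_sq]
      apply Finset.sum_le_sum
      intro j _
      exact mul_le_of_le_one_left (by positivity) (bz_e_le_one Emat hEnn hErow i j)
    have h4 : 0 ≤ ‖∑ k, Emat i k • w k - bzAvg w‖ ^ 2 := by positivity
    linarith
  calc _ ≤ ∑ _i : Fin H, ρ * bzN (fun i => w i - bzAvg w) ^ 2 := Finset.sum_le_sum fun i _ => h1 i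
    _ = _ := by simp; ring

theorem bz_step (hH : 1 ≤ H) (Emat : Matrix (Fin H) (Fin H) ℝ)
    (hEnn : ∀ i j, 0 ≤ Emat i j) (hErow : ∀ i, ∑ j, Emat i j = 1)
    (ρ : ℝ) (hρ : 0 ≤ ρ) (w l : Fin H → EuclideanSpace ℝ (Fin d))
    (hP : ∀ i, ‖l i - ∑ j, Emat i j • w j‖ ^ 2
        ≤ ρ * ∑ j, Emat i j * ‖w j - ∑ k, Emat i k • w k‖ ^ 2) :
    bzN (fun i => l i - bzAvg l) ≤
      (‖LinearMap.toContinuousLinearMap (Matrix.toEuclideanLin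
          (Emat - Matrix.of fun _ j => (H : ℝ)⁻¹ * ∑ k, Emat k j))‖ + Real.sqrt (ρ * H))
        * bzN (fun i => w i - bzAvg w) := by
  have hH' : (H : ℝ) ≠ 0 := by positivity
  set A : Matrix (Fin H) (Fin H) ℝ := (Emat - Matrix.of fun _ j => (H : ℝ)⁻¹ * ∑ k, Emat k j)
    with hA
  set Δ : Fin H → EuclideanSpace ℝ (Fin d) := fun i => l i - ∑ j, Emat i j • w j with hΔ
  have hA0 : ∀ i, ∑ j, A i j = 0 := by
    intro i
    simp only [hA, Matrix.sub_apply, Matrix.of_apply, Finset.sum_sub_distrib, hErow,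
      ← Finset.mul_sum]
    rw [Finset.sum_comm]
    simp [hErow, hH']
  have hAw : ∀ i, ∑ j, A i j • (w j - bzAvg w) =
      ∑ j, Emat i j • w j - bzAvg (fun i => ∑ j, Emat i j • w j) := by
    intro i
    simp only [smul_sub, Finset.sum_sub_distrib, ← Finset.sum_smul, hA0, zero_smul, sub_zero]
    simp only [hA, Matrix.sub_apply, Matrix.of_apply, sub_smul, Finset.sum_sub_distrib]
    congr 1
    unfold bzAvg
    rw [Finset.sum_comm, Finset.smul_sum]
    apply Finset.sum_congr rfl
    intro j _
    rw [← Finset.sum_smul, smul_smul]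
  have hdec : (fun i => l i - bzAvg l) =
      (fun i => ∑ j, A i j • (w j - bzAvg w)) + (fun i => Δ i - bzAvg Δ) := by
    funext i
    simp only [Pi.add_apply, hAw, hΔ]
    have : bzAvg (fun i => l i - ∑ j, Emat i j • w j) =
        bzAvg l - bzAvg (fun i => ∑ j, Emat i j • w j) := by
      simp [bzAvg, smul_sub]
    rw [this]; abel
  rw [hdec]
  refine (bzN_add _ _).trans ?_
  rw [add_mul]
  refine add_le_add (bz_frob A _) ((bzN_center hH Δ).trans ?_)
  apply bzN_le (mul_nonneg (by positivity) (bzN_nonneg _))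
  rw [mul_pow, Real.sq_sqrt (by positivity)]
  exact bz_Delta Emat hEnn hErow ρ hρ w l hP

theorem bz_delta (hH : 1 ≤ H) (Emat : Matrix (Fin H) (Fin H) ℝ)
    (hEnn : ∀ i j, 0 ≤ Emat i j) (hErow : ∀ i, ∑ j, Emat i j = 1)
    (χ : ℝ) (hχ : χ = (H : ℝ)⁻¹ * ∑ j, (∑ i, Emat i j - 1) ^ 2)
    (ρ : ℝ) (hρ : 0 ≤ ρ) (w l : Fin H → EuclideanSpace ℝ (Fin d))
    (hP : ∀ i, ‖l i - ∑ j, Emat i j • w j‖ ^ 2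
        ≤ ρ * ∑ j, Emat i j * ‖w j - ∑ k, Emat i k • w k‖ ^ 2) :
    H * ‖bzAvg l - bzAvg w‖ ^ 2 ≤
      4 / 3 * (4 * ρ * H + χ) * bzN (fun i => w i - bzAvg w) ^ 2 := by
  have hH' : (0 : ℝ) < H := by positivity
  set Δ : Fin H → EuclideanSpace ℝ (Fin d) := fun i => l i - ∑ j, Emat i j • w j with hΔ
  set N2 := bzN (fun i => w i - bzAvg w) ^ 2 with hN2
  set u : EuclideanSpace ℝ (Fin d) :=
    (H : ℝ)⁻¹ • ∑ j, (∑ i, Emat i j - 1) • (w j - bzAvg w) with hu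
  have hsum0 : ∑ j, (∑ i, Emat i j - 1) = 0 := by
    rw [Finset.sum_sub_distrib, Finset.sum_comm]
    simp [hErow]
  have hdec : bzAvg l - bzAvg w = bzAvg Δ + u := by
    rw [hu]
    simp only [smul_sub, Finset.sum_sub_distrib, ← Finset.sum_smul]
    rw [← Finset.sum_sub_distrib, hsum0, zero_smul, smul_zero, sub_zero]
    simp only [sub_smul, one_smul, Finset.sum_sub_distrib, bzAvg, hΔ, smul_sub, Finset.sum_smul]
    rw [Finset.sum_comm (γ := Fin H)]
    abel
  have h1 : H * ‖bzAvg Δ‖ ^ 2 ≤ ρ * H * N2 :=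
    (bz_avg_sq hH Δ).trans (bz_Delta Emat hEnn hErow ρ hρ w l hP)
  have h2 : H * ‖u‖ ^ 2 ≤ χ * N2 := by
    have h := bz_cs (fun j => ∑ i, Emat i j - 1) (fun j => w j - bzAvg w)
    rw [← bzN_sq, ← hN2] at h
    rw [hu, norm_smul, mul_pow, norm_inv, Real.norm_natCast, hχ]
    calc _ = (H : ℝ)⁻¹ * ‖∑ j, (∑ i, Emat i j - 1) • (w j - bzAvg w)‖ ^ 2 := by field_simp
      _ ≤ (H : ℝ)⁻¹ * ((∑ j, (∑ i, Emat i j - 1) ^ 2) * N2) := by gcongr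
      _ = _ := by ring
  have h3 : ‖bzAvg Δ + u‖ ^ 2 ≤ 4 * ‖bzAvg Δ‖ ^ 2 + 4 / 3 * ‖u‖ ^ 2 := by
    have := norm_add_le (bzAvg Δ) u
    have h4 := pow_le_pow_left₀ (norm_nonneg _) this 2
    nlinarith [sq_nonneg (3 * ‖bzAvg Δ‖ - ‖u‖)]
  rw [hdec]
  have h5 := mul_le_mul_of_nonneg_left h3 hH'.le
  have h6 : 0 ≤ ρ * H * N2 := by positivity
  nlinarith
end

theorem bz_dual {V : Type*} [NormedAddCommGroup V] [InnerProductSpace ℝ V]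
    (β θ c : ℝ) (hβ : 0 < β) (hθ : 0 < θ) (hβθ : β * θ < 1) (y g l δ y1 : V)
    (hy1 : y1 = (y + β • (g - θ • y)) + δ) (hc : ‖g - θ • y‖ ≤ c) :
    ‖y1 - l‖ ^ 2 ≤ ‖y - l‖ ^ 2 + 2 * β * ⟪g, y - l⟫ + β * θ * ‖l‖ ^ 2
      + 5 / 4 * β ^ 2 * c ^ 2 + 6 / (β * θ) * ‖δ‖ ^ 2 := by
  set h := g - θ • y with hh
  have hb0 : 0 < β * θ := by positivity
  have e1 : y1 - l = (y - l) + (β • h + δ) := by rw [hy1]; abel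
  have e2 : ‖y1 - l‖ ^ 2 = ‖y - l‖ ^ 2 + 2 * (β * ⟪y - l, h⟫ + ⟪y - l, δ⟫)
      + (β ^ 2 * ‖h‖ ^ 2 + 2 * (β * ⟪h, δ⟫) + ‖δ‖ ^ 2) := by
    rw [e1, norm_add_sq_real, norm_add_sq_real, inner_add_right, inner_smul_right,
      inner_smul_left, norm_smul, mul_pow, Real.norm_eq_abs, sq_abs]
    simp
  have e3 : ⟪y - l, h⟫ = ⟪g, y - l⟫ - θ * ⟪y - l, y⟫ := by
    rw [hh, inner_sub_right, inner_smul_right, real_inner_comm]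
  have e4 : ‖l‖ ^ 2 = ‖y‖ ^ 2 - 2 * ⟪y - l, y⟫ + ‖y - l‖ ^ 2 := by
    have : l = y - (y - l) := by abel
    conv_lhs => rw [this]
    rw [norm_sub_sq_real, real_inner_comm y (y - l)]
  have e5 : 2 * ⟪y - l, δ⟫ ≤ β * θ * ‖y - l‖ ^ 2 + 1 / (β * θ) * ‖δ‖ ^ 2 := by
    have h1 := real_inner_le_norm (y - l) δ
    have h2 : 0 ≤ 1 / (β * θ) * (β * θ * ‖y - l‖ - ‖δ‖) ^ 2 := by positivity
    have h3 : 1 / (β * θ) * (β * θ * ‖y - l‖ - ‖δ‖) ^ 2 =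
      β * θ * ‖y - l‖ ^ 2 - 2 * (‖y - l‖ * ‖δ‖) + 1 / (β * θ) * ‖δ‖ ^ 2 := by
      field_simp; ring
    linarith
  have e6 : 2 * (β * ⟪h, δ⟫) ≤ 1 / 4 * β ^ 2 * ‖h‖ ^ 2 + 4 * ‖δ‖ ^ 2 := by
    have h1 := mul_le_mul_of_nonneg_left (real_inner_le_norm h δ) hβ.le
    nlinarith [sq_nonneg (1 / 2 * β * ‖h‖ - 2 * ‖δ‖)]
  have e7 : β ^ 2 * ‖h‖ ^ 2 ≤ β ^ 2 * c ^ 2 := by gcongr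
  have e8 : 5 * ‖δ‖ ^ 2 + 1 / (β * θ) * ‖δ‖ ^ 2 ≤ 6 / (β * θ) * ‖δ‖ ^ 2 := by
    have : 5 + 1 / (β * θ) ≤ 6 / (β * θ) := by
      rw [le_div_iff₀ hb0, add_mul, one_div, inv_mul_cancel₀ hb0.ne']; linarith
    nlinarith [sq_nonneg ‖δ‖]
  have e9 : β * θ * ‖l‖ ^ 2 = β * θ * ‖y‖ ^ 2 - 2 * (β * θ * ⟪y - l, y⟫) + β * θ * ‖y - l‖ ^ 2 := by
    rw [e4]; ring
  have e10 : 0 ≤ β * θ * ‖y‖ ^ 2 := by positivity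
  rw [e2, e3]
  nlinarith

theorem bz_tele (T : ℕ) (f K Ψ : ℕ → ℝ)
    (h : ∀ t ∈ Finset.Icc 1 T, f t ≤ K t + (Ψ t - Ψ (t + 1))) :
    ∑ t ∈ Finset.Icc 1 T, f t ≤ ∑ t ∈ Finset.Icc 1 T, K t + (Ψ 1 - Ψ (T + 1)) := by
  have h1 : ∀ n, ∑ t ∈ Finset.Icc 1 n, (Ψ t - Ψ (t + 1)) = Ψ 1 - Ψ (n + 1) := by
    intro n
    induction n with
    | zero => simp
    | succ n ih => rw [Finset.sum_Icc_succ_top (by omega), ih]; ring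
  rw [← h1 T, ← Finset.sum_add_distrib]
  exact Finset.sum_le_sum h

/-- consequences of the definition of `ε` -/
theorem bz_eps (a r ε : ℝ) (ha : 0 ≤ a) (hr : 0 ≤ r) (hε : ε = 1 - a ^ 2 - 8 * r) (hε0 : 0 < ε) :
    ε ≤ 1 ∧ a + r < 1 ∧ (1 - (a + r))⁻¹ ≤ 2 / ε ∧
      ((1 - (a + r))⁻¹) ^ 2 * 8 * ε ^ 2 ≤ 16 * (2 - ε) := by
  have ha1 : a < 1 := by nlinarith
  have hr1 : r < 1 := by nlinarith
  have hs2 : (a + r) ^ 2 ≤ 1 - ε := by nlinarith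
  have hs0 : 0 ≤ a + r := by positivity
  set s := a + r
  have hε1 : ε ≤ 1 := by nlinarith
  have hs1 : s ≤ 1 - ε / 2 := by
    apply le_of_sq_le_sq _ (by linarith)
    nlinarith
  have hs : 0 < 1 - s := by linarith
  refine ⟨hε1, by linarith, ?_, ?_⟩
  · rw [inv_le_comm₀ hs (by positivity), inv_div]
    linarith
  · have h1 : (1 - s)⁻¹ * ε ≤ 1 + s := by
      rw [inv_mul_le_iff₀ hs]; nlinarith
    have h2 : ((1 - s)⁻¹ * ε) ^ 2 ≤ (1 + s) ^ 2 := by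
      apply pow_le_pow_left₀ _ h1
      have := inv_pos.2 hs
      positivity
    nlinarith [sq_nonneg (1 - s)]

theorem bz_eps3 (ε : ℝ) (hε0 : 0 < ε) : 2 - ε ≤ (1 + 1 / ε ^ 3) * ε ^ 2 := by
  have : (1 + 1 / ε ^ 3) * ε ^ 2 = ε ^ 2 + 1 / ε := by field_simp
  rw [this]
  have h : 2 - ε ≤ 1 / ε := by
    rw [le_div_iff₀ hε0]; nlinarith [sq_nonneg (1 - ε)]
  nlinarith [sq_nonneg ε]

theorem bz_eps4 (ε : ℝ) (hε0 : 0 < ε) (hε1 : ε ≤ 1) : 1 / ε ≤ 1 / (ε * Real.sqrt ε) := by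
  have h1 : Real.sqrt ε ≤ 1 := Real.sqrt_le_one.2 hε1
  have h0 : 0 < Real.sqrt ε := Real.sqrt_pos.2 hε0
  apply one_div_le_one_div_of_le (by positivity)
  nlinarith

theorem bz_n1 (x p n z b : ℝ) (hp : 0 ≤ p) (hn : 0 ≤ n) (h : x ≤ b) (hz : z = (1 - p) * n + x) :
    z ≤ n + b := by
  nlinarith

theorem bz_n2 (q e w : ℝ) (h : q ^ 2 * 8 * e ^ 2 ≤ 16 * (2 - e)) (h4 : 2 - e ≤ w * e ^ 2) :
    q ^ 2 * e ^ 2 ≤ 2 * w * e ^ 2 := by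
  nlinarith

theorem bz_n3 (n f s : ℝ) (h : n ≤ (f + s) ^ 2) : n ≤ 2 * f ^ 2 + 2 * s ^ 2 := by
  nlinarith [sq_nonneg (f - s)]

theorem bz_n4 (x z u R : ℝ) (h : (x - z) * (x + z) ≤ u * (2 * R)) :
    x ^ 2 ≤ z ^ 2 + 2 * R * u := by
  nlinarith

theorem bz_n5 (n x z e T β γ : ℝ) (h1 : n ≤ (x + z) ^ 2) (h2 : x * z ≤ (β * γ) * (β * T * γ))
    (h3 : x ^ 2 ≤ (β * γ) ^ 2 * T) (he : e = z ^ 2) : n ≤ e + 3 * ((β * γ) ^ 2 * T) := by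
  nlinarith

theorem bz_n6 (H M : ℝ) (hM : 0 ≤ M) : M ^ 2 * (2 * H - M) ≤ M * H ^ 2 := by
  nlinarith [mul_nonneg hM (sq_nonneg (H - M))]

set_option maxHeartbeats 2000000 in
/-- **Accumulative constraint-violation bound for the Byzantine-resilient decentralized online
resource allocation algorithm (Algorithm 2, Theorem 2, violation part).** -/
theorem byzantine_resilient_constraint_violation_bound
    (d H M T : ℕ) (hH : 1 ≤ H) (hHM : H ≤ M) (h2H : M < 2 * H) (hT : 1 ≤ T)
    -- local constraint sets of the benign agents
    (Ω : Fin H → Set (EuclideanSpace ℝ (Fin d)))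
    (hΩne : ∀ i, (Ω i).Nonempty)
    (hΩcomp : ∀ i, IsCompact (Ω i))
    (hΩconv : ∀ i, Convex ℝ (Ω i))
    (R : ℝ) (hR : ∀ i, ∀ x ∈ Ω i, ∀ y ∈ Ω i, ‖x - y‖ ≤ R)
    -- cost functions and their gradients
    (C : Fin H → ℕ → EuclideanSpace ℝ (Fin d) → ℝ)
    (gradC : Fin H → ℕ → EuclideanSpace ℝ (Fin d) → EuclideanSpace ℝ (Fin d))
    (hCconv : ∀ i, ∀ t ≤ T, ConvexOn ℝ Set.univ (C i t))
    (hCgrad : ∀ i, ∀ t ≤ T, ∀ x, HasGradientAt (C i t) (gradC i t x) x)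
    (φ : ℝ) (hφ : ∀ i, ∀ t ≤ T, ∀ x ∈ Ω i, ‖gradC i t x‖ ≤ φ)
    (F : ℝ) (hF : ∀ i, ∀ t ≤ T, ∀ x ∈ Ω i, |C i t x| ≤ F)
    -- demands and local constraint functions
    (D : ℕ → EuclideanSpace ℝ (Fin d))
    (G : Fin H → ℕ → EuclideanSpace ℝ (Fin d) → EuclideanSpace ℝ (Fin d))
    (hG : ∀ i t P, G i t P = (H : ℝ)⁻¹ • (P - D t))
    (ψ : ℝ) (hψ : ∀ i, ∀ t ≤ T, ∀ P ∈ Ω i, ‖G i t P‖ ≤ ψ)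
    -- row-stochastic virtual weight matrix, its contraction data
    (Emat : Matrix (Fin H) (Fin H) ℝ)
    (hEnn : ∀ i j, 0 ≤ Emat i j)
    (hErow : ∀ i, ∑ j, Emat i j = 1)
    (κ : ℝ)
    (hκ : κ = ‖LinearMap.toContinuousLinearMap
        (Matrix.toEuclideanLin
          (Emat - Matrix.of fun _ j => (H : ℝ)⁻¹ * ∑ k, Emat k j))‖ ^ 2)
    (hκlt : κ < 1)
    (χ : ℝ) (hχ : χ = (H : ℝ)⁻¹ * ∑ j, (∑ i, Emat i j - 1) ^ 2)
    (ρ : ℝ) (hρ : 0 ≤ ρ) (hρκ : 8 * Real.sqrt (ρ * H) < 1 - κ)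
    (ε : ℝ) (hε : ε = 1 - κ - 8 * Real.sqrt (ρ * H))
    -- step sizes and regularization parameter
    (α β θ : ℝ) (hα : 0 < α) (hβ : 0 < β) (hθ : 0 < θ)
    (hβθ0 : 0 < β * θ) (hβθ : β * θ < 1)
    -- iterates of Algorithm 2 (benign agents)
    (P lam lamhalf : Fin H → ℕ → EuclideanSpace ℝ (Fin d))
    (hP0 : ∀ i, P i 0 ∈ Ω i)
    (hlam0 : ∀ i, lam i 0 = 0)
    (hPmem : ∀ i, ∀ t ≤ T, P i (t + 1) ∈ Ω i)
    (hPmin : ∀ i, ∀ t ≤ T, ∀ Q ∈ Ω i,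
      ⟪P i (t + 1) - P i t, gradC i t (P i t) + (M : ℝ)⁻¹ • lam i t⟫
          + (1 / (2 * α)) * ‖P i (t + 1) - P i t‖ ^ 2
        ≤ ⟪Q - P i t, gradC i t (P i t) + (M : ℝ)⁻¹ • lam i t⟫
          + (1 / (2 * α)) * ‖Q - P i t‖ ^ 2)
    (hlamhalf : ∀ i, ∀ t ≤ T,
      lamhalf i t
        = lam i t + β • (((H : ℝ) / M) • G i t (P i t) - θ • lam i t))
    -- Property 1: contraction of the robust aggregation step
    (hProp1 : ∀ i, ∀ t ≤ T,
      ‖lam i (t + 1) - ∑ j, Emat i j • lamhalf j t‖ ^ 2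
        ≤ ρ * ∑ j, Emat i j
            * ‖lamhalf j t - ∑ k, Emat i k • lamhalf k t‖ ^ 2)
    -- Property 2: norm bound of the robust aggregation step
    (hProp2 : ∀ i, ∀ t ≤ T,
      ‖lam i (t + 1)‖
        ≤ sSup {r : ℝ | ∃ j, 0 < Emat i j ∧ r = ‖lamhalf j t‖})
    -- comparator sequence
    (Pstar : Fin H → ℕ → EuclideanSpace ℝ (Fin d))
    (hPstar : ∀ i, ∀ t ≤ T, Pstar i t ∈ Ω i)
    (hPstarG : ∀ t ∈ Finset.Icc 1 T, ∑ i, G i t (Pstar i t) = 0) :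
    ‖∑ t ∈ Finset.Icc 1 T, ∑ i, G i t (P i t)‖ ^ 2
      ≤ ((M : ℝ) / (2 * (H : ℝ) - (M : ℝ)))
        * (2 * (H : ℝ) * θ * (T : ℝ) + 2 * (H : ℝ) / β)
        * ((R / α) * ∑ t ∈ Finset.Icc 1 T, ∑ i, ‖Pstar i t - Pstar i (t - 1)‖
          + (1 / (2 * α)) * ∑ i, ‖P i 1 - Pstar i 0‖ ^ 2
          + φ ^ 2 * (H : ℝ) * α * (T : ℝ)
          + ((H : ℝ) * ψ ^ 2 / (M : ℝ) ^ 2) * α * (T : ℝ) / θ ^ 2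
          + (4 * (H : ℝ) ^ 3 * ψ ^ 2 / (ε * Real.sqrt ε * (M : ℝ) ^ 2)
              + (H : ℝ) ^ 3 * ψ ^ 2 / (M : ℝ) ^ 2 + ψ ^ 2 * (H : ℝ))
            * β * (T : ℝ)
          + 2 * (H : ℝ) * F * (T : ℝ)
          + (1 + 1 / ε ^ 3) * (4 * ρ * (H : ℝ) + χ)
              * (8 * (H : ℝ) ^ 3 * ψ ^ 2 / (M : ℝ) ^ 2) * ((T : ℝ) / θ)) := by
  have hHr : (0 : ℝ) < H := by positivity
  have hMr : (0 : ℝ) < M := by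
    have : 1 ≤ M := hH.trans hHM
    positivity
  have hHMr : (H : ℝ) ≤ M := by exact_mod_cast hHM
  have hTr : (1 : ℝ) ≤ T := by exact_mod_cast hT
  have h2Hr : (0 : ℝ) < 2 * H - M := by
    have : (M : ℝ) < 2 * H := by exact_mod_cast h2H
    linarith
  have hP : ∀ i, ∀ t ≤ T + 1, P i t ∈ Ω i := by
    intro i t ht
    cases t with
    | zero => exact hP0 i
    | succ n => exact hPmem i n (by omega)
  have hGP : ∀ i, ∀ t ≤ T, ‖G i t (P i t)‖ ≤ ψ := fun i t ht =>
    hψ i t ht _ (hP i t (by omega))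
  have hψ0 : 0 ≤ ψ := (norm_nonneg _).trans (hGP ⟨0, hH⟩ 0 (Nat.zero_le _))
  have hR0 : 0 ≤ R := by simpa using hR ⟨0, hH⟩ _ (hP0 _) _ (hP0 _)
  -- abbreviations
  set γ : ℝ := (H : ℝ) / M with hγ
  have hγ0 : 0 < γ := by positivity
  have hγ1 : γ ≤ 1 := by rw [hγ, div_le_one hMr]; exact hHMr
  clear_value γ
  have hGt : ∀ i, ∀ t ≤ T, ‖γ • G i t (P i t)‖ ≤ γ * ψ := by
    intro i t ht
    rw [norm_smul, Real.norm_eq_abs, abs_of_pos hγ0]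
    exact mul_le_mul_of_nonneg_left (hGP i t ht) hγ0.le
  have hhalf : ∀ i, ∀ t ≤ T,
      lamhalf i t = (1 - β * θ) • lam i t + β • (γ • G i t (P i t)) := by
    intro i t ht
    rw [hlamhalf i t ht]; module
  have hhalfn : ∀ i, ∀ t ≤ T, ‖lamhalf i t‖ ≤ (1 - β * θ) * ‖lam i t‖ + β * (γ * ψ) := by
    intro i t ht
    rw [hhalf i t ht]
    refine (norm_add_le _ _).trans ?_
    rw [norm_smul, norm_smul _ (γ • _), Real.norm_eq_abs, Real.norm_eq_abs, abs_of_pos hβ,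
      abs_of_pos (by linarith : 0 < 1 - β * θ)]
    have := mul_le_mul_of_nonneg_left (hGt i t ht) hβ.le
    linarith
  have hsup : ∀ t ≤ T, ∀ c, (∀ j, ‖lamhalf j t‖ ≤ c) → ∀ i, ‖lam i (t + 1)‖ ≤ c := by
    intro t ht c hc i
    refine (hProp2 i t ht).trans ?_
    apply csSup_le
    · by_contra hne
      rw [Set.not_nonempty_iff_eq_empty] at hne
      have h0 : ∀ j, Emat i j = 0 := by
        intro j
        by_contra hj
        have hpos : 0 < Emat i j := lt_of_le_of_ne (hEnn i j) (Ne.symm hj)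
        have hm : ‖lamhalf j t‖ ∈ {r : ℝ | ∃ j, 0 < Emat i j ∧ r = ‖lamhalf j t‖} := ⟨j, hpos, rfl⟩
        rw [hne] at hm
        exact hm
      have := hErow i
      simp [h0] at this
    · rintro r ⟨j, -, rfl⟩
      exact hc j
  have hlamb : ∀ t ≤ T + 1, ∀ i, ‖lam i t‖ ≤ γ * ψ / θ := by
    intro t
    induction t with
    | zero => intro _ i; rw [hlam0]; simp; positivity
    | succ n ih =>
      intro ht
      apply hsup n (by omega)
      intro j
      refine (hhalfn j n (by omega)).trans ?_
      have h1 := mul_le_mul_of_nonneg_left (ih (by omega) j) (by linarith : 0 ≤ 1 - β * θ)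
      have h2 : (1 - β * θ) * (γ * ψ / θ) + β * (γ * ψ) = γ * ψ / θ := by field_simp; ring
      linarith
  have hlam1 : ∀ i, ‖lam i 1‖ ≤ β * (γ * ψ) := by
    apply hsup 0 (by omega)
    intro j
    have := hhalfn j 0 (by omega)
    rw [hlam0] at this
    simpa using this
  -- averages
  set y : ℕ → EuclideanSpace ℝ (Fin d) := fun t => bzAvg (fun i => lam i t) with hy
  set m : ℕ → EuclideanSpace ℝ (Fin d) := fun t => bzAvg (fun i => lamhalf i t) with hm
  set g : ℕ → EuclideanSpace ℝ (Fin d) := fun t => bzAvg (fun i => γ • G i t (P i t)) with hg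
  have hmy : ∀ t ≤ T, m t = y t + β • (g t - θ • y t) := by
    intro t ht
    have h1 : (fun i => lamhalf i t) =
        fun i => (1 - β * θ) • lam i t + β • (γ • G i t (P i t)) := by
      funext i; exact hhalf i t ht
    simp only [hm, h1, hy, hg, bzAvg, Finset.sum_add_distrib, ← Finset.smul_sum]
    module
  have hyb : ∀ t ≤ T + 1, ‖y t‖ ≤ γ * ψ / θ := fun t ht => bz_avg_norm hH _ _ (hlamb t ht)
  have hgb : ∀ t ≤ T, ‖g t‖ ≤ γ * ψ := fun t ht => bz_avg_norm hH _ _ fun i => hGt i t ht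
  have hy1b : ‖y 1‖ ≤ β * (γ * ψ) := bz_avg_norm hH _ _ hlam1
  have hgy : ∀ t ≤ T, ‖g t - θ • y t‖ ≤ 2 * (γ * ψ) := by
    intro t ht
    refine (norm_sub_le _ _).trans ?_
    rw [norm_smul, Real.norm_eq_abs, abs_of_pos hθ]
    have h1 := mul_le_mul_of_nonneg_left (hyb t (by omega)) hθ.le
    have h2 : θ * (γ * ψ / θ) = γ * ψ := by field_simp
    linarith [hgb t ht]
  -- consensus error
  set a := ‖LinearMap.toContinuousLinearMap
        (Matrix.toEuclideanLin
          (Emat - Matrix.of fun _ j => (H : ℝ)⁻¹ * ∑ k, Emat k j))‖ with ha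
  have ha0 : 0 ≤ a := norm_nonneg _
  set r := Real.sqrt (ρ * H) with hr
  have hr0 : 0 ≤ r := Real.sqrt_nonneg _
  have hε0 : 0 < ε := by linarith
  obtain ⟨hε1, hs1, hq1, hq2⟩ := bz_eps a r ε ha0 hr0 (by rw [hε, hκ]) hε0
  set b : ℝ := β * (Real.sqrt H * (γ * ψ)) with hb
  have hb0 : 0 ≤ b := by positivity
  clear_value b
  set q : ℝ := (1 - (a + r))⁻¹ with hq
  have hq0 : 0 < q := inv_pos.2 (by linarith)
  have hqs : (a + r) * q = q - 1 := by
    have : (1 - (a + r)) * q = 1 := mul_inv_cancel₀ (by linarith)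
    linarith
  clear_value q
  set NX : ℕ → ℝ := fun t => bzN (fun i => lam i t - y t) with hNX
  set NZ : ℕ → ℝ := fun t => bzN (fun i => lamhalf i t - m t) with hNZ
  have hZX : ∀ t ≤ T, NZ t ≤ NX t + b := by
    intro t ht
    have h1 : (fun i => lamhalf i t - m t) = (1 - β * θ) • (fun i => lam i t - y t)
        + β • (fun i => γ • G i t (P i t) - g t) := by
      funext i
      simp only [Pi.add_apply, Pi.smul_apply]
      rw [hmy t ht, hhalf i t ht]; module
    have h2 : bzN (fun i => γ • G i t (P i t) - g t) ≤ Real.sqrt H * (γ * ψ) := by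
      refine (bzN_center hH (fun i => γ • G i t (P i t))).trans ?_
      apply bzN_le (by positivity)
      rw [mul_pow, Real.sq_sqrt hHr.le]
      calc _ ≤ ∑ _i : Fin H, (γ * ψ) ^ 2 := Finset.sum_le_sum fun i _ =>
            pow_le_pow_left₀ (norm_nonneg _) (hGt i t ht) 2
        _ = _ := by simp
    simp only [hNZ, hNX, h1]
    refine (bzN_add _ _).trans ?_
    rw [bzN_smul, bzN_smul, abs_of_pos hβ, abs_of_pos (by linarith : 0 < 1 - β * θ)]
    have h3 := mul_le_mul_of_nonneg_left h2 hβ.le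
    have h4 := bzN_nonneg (fun i => lam i t - y t)
    exact bz_n1 _ (β * θ) _ _ b hβθ0.le h4 (by rw [hb]; exact h3) rfl
  have hXZ : ∀ t ≤ T, NX (t + 1) ≤ (a + r) * NZ t := by
    intro t ht
    exact bz_step hH Emat hEnn hErow ρ hρ (fun i => lamhalf i t) (fun i => lam i (t + 1))
      (fun i => hProp1 i t ht)
  clear_value a r
  have hXb : ∀ t ≤ T + 1, NX t ≤ (q - 1) * b := by
    intro t
    induction t with
    | zero =>
      intro _
      have h1 : NX 0 = 0 := by
        have : (fun i => lam i 0 - y 0) = (0 : Fin H → EuclideanSpace ℝ (Fin d)) := by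
          funext i; simp [hy, hlam0, bzAvg]
        simp only [hNX, this]
        simp [bzN]
      rw [h1, ← hqs]; positivity
    | succ n ih =>
      intro ht
      refine (hXZ n (by omega)).trans ?_
      have h1 : NZ n ≤ q * b := by
        have h2 := hZX n (by omega)
        have h3 := ih (by omega)
        linarith
      rw [← hqs, mul_assoc]
      exact mul_le_mul_of_nonneg_left h1 (by positivity)
  have hZb : ∀ t ≤ T, NZ t ≤ q * b := by
    intro t ht
    have h2 := hZX t ht
    have h3 := hXb t (by omega)
    linarith
  have hχ0 : 0 ≤ χ := by rw [hχ]; positivity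
  -- the unit
  set U : ℝ := H ^ 3 * ψ ^ 2 / M ^ 2 * β with hU
  have hU0 : 0 ≤ U := by positivity
  clear_value U
  have hUγ : U = H * (γ * ψ) ^ 2 * β := by rw [hU, hγ]; field_simp
  have hb2 : b ^ 2 = β * U := by
    rw [hb, mul_pow, mul_pow, Real.sq_sqrt hHr.le, hUγ]; ring
  have hδ : ∀ t ≤ T, H / (2 * β) * (6 / (β * θ) * ‖y (t + 1) - m t‖ ^ 2) ≤
      (1 + 1 / ε ^ 3) * (4 * ρ * H + χ) * (8 * (H : ℝ) ^ 3 * ψ ^ 2 / M ^ 2) * (1 / θ) := by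
    intro t ht
    have h1 := bz_delta hH Emat hEnn hErow χ hχ ρ hρ (fun i => lamhalf i t)
      (fun i => lam i (t + 1)) (fun i => hProp1 i t ht)
    change H * ‖y (t + 1) - m t‖ ^ 2 ≤ 4 / 3 * (4 * ρ * H + χ) * NZ t ^ 2 at h1
    have h2 : NZ t ^ 2 ≤ q ^ 2 * b ^ 2 := by
      rw [← mul_pow]
      exact pow_le_pow_left₀ (bzN_nonneg _) (hZb t ht) 2
    have h3 : q ^ 2 ≤ 2 * (1 + 1 / ε ^ 3) := by
      have h4 := bz_eps3 ε hε0
      have : q ^ 2 * ε ^ 2 ≤ 2 * (1 + 1 / ε ^ 3) * ε ^ 2 :=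
        bz_n2 q ε _ hq2 h4
      exact le_of_mul_le_mul_right this (by positivity)
    have h5 : NZ t ^ 2 ≤ 2 * (1 + 1 / ε ^ 3) * b ^ 2 :=
      h2.trans (mul_le_mul_of_nonneg_right h3 (by positivity))
    have h6 : 0 ≤ 4 / 3 * (4 * ρ * H + χ) := by positivity
    have h7 := h1.trans (mul_le_mul_of_nonneg_left h5 h6)
    have h8 := mul_le_mul_of_nonneg_left h7 (by positivity : 0 ≤ 3 / (β ^ 2 * θ))
    calc _ = 3 / (β ^ 2 * θ) * (H * ‖y (t + 1) - m t‖ ^ 2) := by field_simp; ring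
      _ ≤ _ := h8
      _ = _ := by rw [hb2, hU]; field_simp; ring
  clear_value m NZ
  -- dual step
  have hdual : ∀ l : EuclideanSpace ℝ (Fin d), ∀ t ≤ T,
      H * ⟪g t, l - y t⟫ ≤ (H / (2 * β) * ‖y t - l‖ ^ 2 - H / (2 * β) * ‖y (t + 1) - l‖ ^ 2)
        + H * θ / 2 * ‖l‖ ^ 2 + 5 / 2 * U
        + (1 + 1 / ε ^ 3) * (4 * ρ * H + χ) * (8 * (H : ℝ) ^ 3 * ψ ^ 2 / M ^ 2) * (1 / θ) := by
    intro l t ht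
    have h1 := bz_dual β θ (2 * (γ * ψ)) hβ hθ hβθ (y t) (g t) l (y (t + 1) - m t) (y (t + 1))
      (by rw [← hmy t ht]; abel) (hgy t ht)
    have h2 := mul_le_mul_of_nonneg_left h1 (by positivity : 0 ≤ H / (2 * β))
    have h3 := hδ t ht
    have h4 : H / (2 * β) * (‖y t - l‖ ^ 2 + 2 * β * ⟪g t, y t - l⟫ + β * θ * ‖l‖ ^ 2
      + 5 / 4 * β ^ 2 * (2 * (γ * ψ)) ^ 2 + 6 / (β * θ) * ‖y (t + 1) - m t‖ ^ 2) =
      H / (2 * β) * ‖y t - l‖ ^ 2 + H * ⟪g t, y t - l⟫ + H * θ / 2 * ‖l‖ ^ 2 + 5 / 2 * U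
      + H / (2 * β) * (6 / (β * θ) * ‖y (t + 1) - m t‖ ^ 2) := by
      rw [hUγ]; field_simp; ring
    have h5 : ⟪g t, l - y t⟫ = - ⟪g t, y t - l⟫ := by
      rw [← inner_neg_right]; congr 1; abel
    rw [h5]
    linarith
  -- primal step
  have hprimal : ∀ t ∈ Finset.Icc 1 T, ∀ i,
      ⟪P i t - Pstar i t, (M : ℝ)⁻¹ • lam i t⟫ ≤
        (1 / (2 * α) * ‖P i t - Pstar i (t - 1)‖ ^ 2
          - 1 / (2 * α) * ‖P i (t + 1) - Pstar i t‖ ^ 2)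
        + R / α * ‖Pstar i t - Pstar i (t - 1)‖ + φ ^ 2 * α + ψ ^ 2 / M ^ 2 * α / θ ^ 2
        + 2 * F := by
    intro t ht i
    rw [Finset.mem_Icc] at ht
    have h1 := bz_prox (Ω i) (hΩconv i) α hα (P i (t + 1)) (P i t)
      (gradC i t (P i t) + (M : ℝ)⁻¹ • lam i t) (hPmem i t ht.2) (hPmin i t ht.2)
      (Pstar i t) (hPstar i t ht.2)
    rw [inner_add_right] at h1
    have h2 := bz_grad (C i t) (hCconv i t ht.2) (P i t) (gradC i t (P i t)) (Pstar i t)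
      (hCgrad i t ht.2 _)
    have h3 := abs_le.1 (hF i t ht.2 (P i t) (hP i t (by omega)))
    have h4 := abs_le.1 (hF i t ht.2 (Pstar i t) (hPstar i t ht.2))
    have h5 : ‖gradC i t (P i t) + (M : ℝ)⁻¹ • lam i t‖ ^ 2 ≤
        2 * φ ^ 2 + 2 * (ψ ^ 2 / M ^ 2 / θ ^ 2) := by
      have k1 := norm_add_le (gradC i t (P i t)) ((M : ℝ)⁻¹ • lam i t)
      have k2 := hφ i t ht.2 (P i t) (hP i t (by omega))
      have k3 : ‖(M : ℝ)⁻¹ • lam i t‖ ≤ ψ / M / θ := by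
        rw [norm_smul, norm_inv, Real.norm_natCast]
        have k4 : ‖lam i t‖ ≤ ψ / θ := by
          refine (hlamb t (by omega) i).trans ?_
          gcongr
          exact mul_le_of_le_one_left hψ0 hγ1
        calc _ ≤ (M : ℝ)⁻¹ * (ψ / θ) := by gcongr
          _ = _ := by field_simp
      have k5 : ‖gradC i t (P i t) + (M : ℝ)⁻¹ • lam i t‖ ^ 2 ≤ (φ + ψ / M / θ) ^ 2 :=
        pow_le_pow_left₀ (norm_nonneg _) (by linarith) 2
      have k6 : ψ ^ 2 / M ^ 2 / θ ^ 2 = (ψ / M / θ) ^ 2 := by rw [div_pow, div_pow]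
      rw [k6]
      exact bz_n3 _ _ _ k5
    have h6 := mul_le_mul_of_nonneg_left h5 (by positivity : 0 ≤ α / 2)
    have h7 : ‖P i t - Pstar i t‖ ^ 2 ≤ ‖P i t - Pstar i (t - 1)‖ ^ 2
        + 2 * R * ‖Pstar i t - Pstar i (t - 1)‖ := by
      have k1 := hR i _ (hP i t (by omega)) _ (hPstar i t ht.2)
      have k2 := hR i _ (hP i t (by omega)) _ (hPstar i (t - 1) (by omega))
      have k3 : ‖P i t - Pstar i t‖ ≤
          ‖P i t - Pstar i (t - 1)‖ + ‖Pstar i t - Pstar i (t - 1)‖ := by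
        rw [norm_sub_rev (Pstar i t)]
        refine le_trans (le_of_eq ?_) (norm_add_le _ _)
        congr 1; abel
      have k4 : (‖P i t - Pstar i t‖ - ‖P i t - Pstar i (t - 1)‖) *
          (‖P i t - Pstar i t‖ + ‖P i t - Pstar i (t - 1)‖) ≤
          ‖Pstar i t - Pstar i (t - 1)‖ * (2 * R) := by
        refine (mul_le_mul_of_nonneg_right (by linarith : _ ≤ ‖Pstar i t - Pstar i (t - 1)‖)
          (by positivity)).trans ?_
        exact mul_le_mul_of_nonneg_left (by linarith) (norm_nonneg _)
      exact bz_n4 _ _ _ _ k4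
    have h8 := mul_le_mul_of_nonneg_left h7 (by positivity : 0 ≤ 1 / (2 * α))
    have h9 : 1 / (2 * α) * (‖P i t - Pstar i (t - 1)‖ ^ 2
        + 2 * R * ‖Pstar i t - Pstar i (t - 1)‖) = 1 / (2 * α) * ‖P i t - Pstar i (t - 1)‖ ^ 2
        + R / α * ‖Pstar i t - Pstar i (t - 1)‖ := by field_simp
    have h10 : α / 2 * (2 * φ ^ 2 + 2 * (ψ ^ 2 / M ^ 2 / θ ^ 2)) =
      φ ^ 2 * α + ψ ^ 2 / M ^ 2 * α / θ ^ 2 := by ring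
    rw [mul_sub] at h1
    linarith
  -- linking the primal and the dual parts
  have hlink : ∀ t ∈ Finset.Icc 1 T,
      H * ⟪g t, y t⟫ ≤ ∑ i, ⟪P i t - Pstar i t, (M : ℝ)⁻¹ • lam i t⟫ + (4 / ε - 2) * U := by
    intro t ht
    have ht' := Finset.mem_Icc.1 ht
    have h1 : ∀ i, ⟪P i t - Pstar i t, (M : ℝ)⁻¹ • lam i t⟫ =
        γ * ⟪G i t (P i t) - G i t (Pstar i t), lam i t - y t⟫
          + γ * ⟪G i t (P i t), y t⟫ - γ * ⟪G i t (Pstar i t), y t⟫ := by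
      intro i
      have k : P i t - Pstar i t = (H : ℝ) • (G i t (P i t) - G i t (Pstar i t)) := by
        rw [hG, hG, ← smul_sub, smul_smul, mul_inv_cancel₀ hHr.ne', one_smul]; abel
      rw [k, inner_smul_left, inner_smul_right, inner_sub_right, inner_sub_left _ _ (y t), hγ]
      simp only [conj_trivial]
      ring
    have h2 : ∑ i, γ * ⟪G i t (P i t), y t⟫ = H * ⟪g t, y t⟫ := by
      simp only [hg, bzAvg]
      rw [inner_smul_left, sum_inner]
      simp only [inner_smul_left, conj_trivial]
      field_simp
    have h3 : ∑ i, γ * ⟪G i t (Pstar i t), y t⟫ = 0 := by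
      rw [← Finset.mul_sum, ← sum_inner, hPstarG t ht]; simp
    have h4 : - ((4 / ε - 2) * U) ≤
        ∑ i, γ * ⟪G i t (P i t) - G i t (Pstar i t), lam i t - y t⟫ := by
      have k1 : ∀ i, - (2 * (γ * ψ) * ‖lam i t - y t‖) ≤
          γ * ⟪G i t (P i t) - G i t (Pstar i t), lam i t - y t⟫ := by
        intro i
        have j1 := abs_le.1 (abs_real_inner_le_norm (G i t (P i t) - G i t (Pstar i t))
          (lam i t - y t))
        have j2 : ‖G i t (P i t) - G i t (Pstar i t)‖ ≤ 2 * ψ := by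
          have := norm_sub_le (G i t (P i t)) (G i t (Pstar i t))
          linarith [hGP i t ht'.2, hψ i t ht'.2 _ (hPstar i t ht'.2)]
        have j3 := mul_le_mul_of_nonneg_right j2 (norm_nonneg (lam i t - y t))
        have j4 : -(2 * ψ * ‖lam i t - y t‖) ≤
          ⟪G i t (P i t) - G i t (Pstar i t), lam i t - y t⟫ := by linarith [j1.1]
        have j5 := mul_le_mul_of_nonneg_left j4 hγ0.le
        linarith
      have k2 := Finset.sum_le_sum fun i (_ : i ∈ Finset.univ) => k1 i
      rw [Finset.sum_neg_distrib, ← Finset.mul_sum] at k2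
      have k3 : ∑ i, ‖lam i t - y t‖ ≤ Real.sqrt H * NX t := bz_l1 (fun i => lam i t - y t)
      have k4 : Real.sqrt H * NX t ≤ Real.sqrt H * ((2 / ε - 1) * b) := by
        gcongr
        refine (hXb t (by omega)).trans ?_
        exact mul_le_mul_of_nonneg_right (by linarith) hb0
      have k5 := mul_le_mul_of_nonneg_left (k3.trans k4) (by positivity : 0 ≤ 2 * (γ * ψ))
      have k6 : 2 * (γ * ψ) * (Real.sqrt H * ((2 / ε - 1) * b)) = (4 / ε - 2) * U := by
        rw [hb, hUγ]
        have : Real.sqrt H * Real.sqrt H = H := Real.mul_self_sqrt hHr.le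
        linear_combination (2 * (γ * ψ) ^ 2 * (2 / ε - 1) * β) * this
      linarith
    simp_rw [h1]
    rw [Finset.sum_sub_distrib, Finset.sum_add_distrib, h2, h3]
    linarith
  clear_value NX y g
  -- constants
  set W : ℝ := (1 + 1 / ε ^ 3) * (4 * ρ * H + χ) * (8 * (H : ℝ) ^ 3 * ψ ^ 2 / M ^ 2) * (1 / θ)
    with hW
  clear_value W
  set S : EuclideanSpace ℝ (Fin d) := ∑ t ∈ Finset.Icc 1 T, ∑ i, G i t (P i t) with hS
  have hmain : ∀ l : EuclideanSpace ℝ (Fin d), γ * ⟪S, l⟫ ≤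
      (R / α) * ∑ t ∈ Finset.Icc 1 T, ∑ i, ‖Pstar i t - Pstar i (t - 1)‖
      + T * (H * (φ ^ 2 * α + ψ ^ 2 / M ^ 2 * α / θ ^ 2 + 2 * F)
        + H * θ / 2 * ‖l‖ ^ 2 + (4 / ε + 1 / 2) * U + W)
      + (1 / (2 * α)) * ∑ i, ‖P i 1 - Pstar i 0‖ ^ 2 + H / (2 * β) * ‖y 1 - l‖ ^ 2 := by
    intro l
    have h1 := bz_tele T (fun t => γ * ⟪∑ i, G i t (P i t), l⟫)
      (fun t => (R / α) * ∑ i, ‖Pstar i t - Pstar i (t - 1)‖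
        + (H * (φ ^ 2 * α + ψ ^ 2 / M ^ 2 * α / θ ^ 2 + 2 * F)
        + H * θ / 2 * ‖l‖ ^ 2 + (4 / ε + 1 / 2) * U + W))
      (fun t => (1 / (2 * α)) * ∑ i, ‖P i t - Pstar i (t - 1)‖ ^ 2 + H / (2 * β) * ‖y t - l‖ ^ 2)
      (by
        intro t ht
        have ht' := Finset.mem_Icc.1 ht
        have k1 := hdual l t ht'.2
        have k2 := hlink t ht
        have k3 := Finset.sum_le_sum fun i (_ : i ∈ Finset.univ) => hprimal t ht i
        have k4 : γ * ⟪∑ i, G i t (P i t), l⟫ = H * ⟪g t, l⟫ := by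
          simp only [hg, bzAvg]
          rw [← Finset.smul_sum, inner_smul_left, inner_smul_left]
          simp only [conj_trivial]
          field_simp
        simp only [Finset.sum_add_distrib, Finset.sum_sub_distrib, ← Finset.mul_sum,
          Finset.sum_const, Finset.card_univ, Fintype.card_fin, nsmul_eq_mul] at k3
        rw [inner_sub_right] at k1
        simp only [Nat.add_sub_cancel]
        rw [k4]
        linarith)
    simp only [Nat.add_sub_cancel, Nat.sub_self] at h1
    rw [← Finset.mul_sum, ← sum_inner, Finset.sum_add_distrib, ← Finset.mul_sum,
      Finset.sum_const, Nat.card_Icc, Nat.add_sub_cancel, nsmul_eq_mul] at h1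
    have h2 : 0 ≤ (1 / (2 * α)) * ∑ i, ‖P i (T + 1) - Pstar i T‖ ^ 2
        + H / (2 * β) * ‖y (T + 1) - l‖ ^ 2 := by positivity
    rw [← hS] at h1
    linarith
  -- choose the multiplier
  have hSn : ‖S‖ ≤ T * (H * ψ) := by
    calc ‖S‖ ≤ ∑ t ∈ Finset.Icc 1 T, ‖∑ i, G i t (P i t)‖ := norm_sum_le _ _
      _ ≤ ∑ t ∈ Finset.Icc 1 T, (H * ψ) := by
        apply Finset.sum_le_sum
        intro t ht
        refine (norm_sum_le _ _).trans ?_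
        calc _ ≤ ∑ _i : Fin H, ψ := Finset.sum_le_sum fun i _ => hGP i t (Finset.mem_Icc.1 ht).2
          _ = _ := by simp
      _ = _ := by simp
  clear_value S
  set A : ℝ := H * θ * T + H / β with hA
  have hA0 : 0 < A := by positivity
  clear_value A
  set c : ℝ := γ / A with hc
  have hc0 : 0 < c := by positivity
  clear_value c
  have hln : ‖c • S‖ ≤ β * T * (γ * ψ) := by
    rw [norm_smul, Real.norm_eq_abs, abs_of_pos hc0]
    have k1 : c ≤ γ / (H / β) := by
      rw [hc]
      apply div_le_div_of_nonneg_left hγ0.le (by positivity)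
      rw [hA]
      have : 0 ≤ H * θ * T := by positivity
      linarith
    calc c * ‖S‖ ≤ γ / (H / β) * (T * (H * ψ)) := by gcongr
      _ = _ := by field_simp
  have hinit : H / (2 * β) * ‖y 1 - c • S‖ ^ 2 ≤ H / (2 * β) * ‖c • S‖ ^ 2 + T * (3 / 2 * U) := by
    have k1 : ‖y 1 - c • S‖ ^ 2 ≤ (‖y 1‖ + ‖c • S‖) ^ 2 :=
      pow_le_pow_left₀ (norm_nonneg _) (norm_sub_le _ _) 2
    have k2 : ‖y 1‖ * ‖c • S‖ ≤ (β * (γ * ψ)) * (β * T * (γ * ψ)) :=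
      mul_le_mul hy1b hln (norm_nonneg _) (by positivity)
    have k3 : ‖y 1‖ ^ 2 ≤ (β * (γ * ψ)) ^ 2 * T :=
      (pow_le_pow_left₀ (norm_nonneg _) hy1b 2).trans
        (le_mul_of_one_le_right (by positivity) hTr)
    have k4 : ‖y 1 - c • S‖ ^ 2 ≤ ‖c • S‖ ^ 2 + 3 * ((β * (γ * ψ)) ^ 2 * T) :=
      bz_n5 _ _ _ _ _ _ _ k1 k2 k3 rfl
    refine (mul_le_mul_of_nonneg_left k4 (by positivity)).trans (le_of_eq ?_)
    rw [hUγ]; field_simp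
  have hfin := hmain (c • S)
  rw [inner_smul_right, real_inner_self_eq_norm_sq] at hfin
  have hcS : ‖c • S‖ ^ 2 = c ^ 2 * ‖S‖ ^ 2 := by
    rw [norm_smul, mul_pow, Real.norm_eq_abs, sq_abs]
  set B : ℝ := (R / α) * ∑ t ∈ Finset.Icc 1 T, ∑ i, ‖Pstar i t - Pstar i (t - 1)‖
          + (1 / (2 * α)) * ∑ i, ‖P i 1 - Pstar i 0‖ ^ 2
          + φ ^ 2 * (H : ℝ) * α * (T : ℝ)
          + ((H : ℝ) * ψ ^ 2 / (M : ℝ) ^ 2) * α * (T : ℝ) / θ ^ 2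
          + (4 * (H : ℝ) ^ 3 * ψ ^ 2 / (ε * Real.sqrt ε * (M : ℝ) ^ 2)
              + (H : ℝ) ^ 3 * ψ ^ 2 / (M : ℝ) ^ 2 + ψ ^ 2 * (H : ℝ))
            * β * (T : ℝ)
          + 2 * (H : ℝ) * F * (T : ℝ)
          + (1 + 1 / ε ^ 3) * (4 * ρ * (H : ℝ) + χ)
              * (8 * (H : ℝ) ^ 3 * ψ ^ 2 / (M : ℝ) ^ 2) * ((T : ℝ) / θ) with hB
  clear_value B
  have hUH : U ≤ ψ ^ 2 * H * β := by
    rw [hUγ]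
    have k1 : (γ * ψ) ^ 2 ≤ ψ ^ 2 :=
      pow_le_pow_left₀ (by positivity) (mul_le_of_le_one_left hψ0 hγ1) 2
    calc H * (γ * ψ) ^ 2 * β ≤ H * ψ ^ 2 * β := by gcongr
      _ = _ := by ring
  have hUε : 4 / ε * U ≤ 4 * (H : ℝ) ^ 3 * ψ ^ 2 / (ε * Real.sqrt ε * (M : ℝ) ^ 2) * β := by
    have k1 := mul_le_mul_of_nonneg_right (bz_eps4 ε hε0 hε1) (by positivity : 0 ≤ 4 * U)
    have k0 : 0 < Real.sqrt ε := Real.sqrt_pos.2 hε0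
    calc _ = 1 / ε * (4 * U) := by ring
      _ ≤ _ := k1
      _ = _ := by rw [hU]; field_simp
  have hkey : γ ^ 2 / (2 * A) * ‖S‖ ^ 2 ≤ B := by
    have k1 : γ * (c * ‖S‖ ^ 2) - (T * (H * θ / 2 * (c ^ 2 * ‖S‖ ^ 2))
        + H / (2 * β) * (c ^ 2 * ‖S‖ ^ 2)) = γ ^ 2 / (2 * A) * ‖S‖ ^ 2 := by
      have : T * (H * θ / 2 * (c ^ 2 * ‖S‖ ^ 2)) + H / (2 * β) * (c ^ 2 * ‖S‖ ^ 2)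
          = A / 2 * c ^ 2 * ‖S‖ ^ 2 := by rw [hA]; ring
      rw [this, hc]; field_simp; ring
    have k2 : T * ((4 / ε + 2) * U) ≤
        (4 * (H : ℝ) ^ 3 * ψ ^ 2 / (ε * Real.sqrt ε * (M : ℝ) ^ 2)
              + (H : ℝ) ^ 3 * ψ ^ 2 / (M : ℝ) ^ 2 + ψ ^ 2 * (H : ℝ)) * β * (T : ℝ) := by
      rw [mul_comm (T : ℝ)]
      refine mul_le_mul_of_nonneg_right ?_ (by linarith)
      rw [add_mul, add_mul, add_mul, ← hU]
      linarith
    have k3 : (1 + 1 / ε ^ 3) * (4 * ρ * (H : ℝ) + χ)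
              * (8 * (H : ℝ) ^ 3 * ψ ^ 2 / (M : ℝ) ^ 2) * ((T : ℝ) / θ) = T * W := by
      rw [hW]; ring
    have k4 : T * (H * (φ ^ 2 * α + ψ ^ 2 / M ^ 2 * α / θ ^ 2 + 2 * F)) =
      φ ^ 2 * (H : ℝ) * α * (T : ℝ) + ((H : ℝ) * ψ ^ 2 / (M : ℝ) ^ 2) * α * (T : ℝ) / θ ^ 2
        + 2 * (H : ℝ) * F * (T : ℝ) := by ring
    rw [hcS] at hinit hfin
    rw [hB, k3]
    linarith
  have hBnn : 0 ≤ B := le_trans (by positivity) hkey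
  have hstep : ‖S‖ ^ 2 ≤ 1 / γ ^ 2 * (2 * A) * B := by
    have := mul_le_mul_of_nonneg_left hkey (by positivity : 0 ≤ 1 / γ ^ 2 * (2 * A))
    refine le_trans (le_of_eq ?_) this
    field_simp
  have hcoef : 1 / γ ^ 2 ≤ (M : ℝ) / (2 * H - M) := by
    rw [hγ, div_pow, one_div_div, div_le_div_iff₀ (by positivity) h2Hr]
    exact bz_n6 _ _ hMr.le
  have h2A : 2 * (H : ℝ) * θ * T + 2 * H / β = 2 * A := by rw [hA]; ring
  rw [h2A]
  refine hstep.trans ?_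
  exact mul_le_mul_of_nonneg_right (mul_le_mul_of_nonneg_right hcoef (by positivity)) hBnn
end
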